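/- (Main theorem, second component) There exists an open connected set A₂ ⊆ ℝ² containing the segment I₂ = [2.21875, 2.296875] × {0.25} such that for every (a,b) ∈ A₂, the Hénon map H_{a,b} restricted to K^ℝ_{a,b} is topologically conjugate to the shift σ restricted to Fix(ρ_{0,2}): there exists a homeomorphism h from K^ℝ_{a,b} (with the subspace topology of ℝ²) onto Fix(ρ_{0,2}) (with the subspace topology of Σ₂) such that h(H_{a,b}(p)) = σ(h(p)) for all p ∈ K^ℝ_{a,b}. -/

import Mathlib

/-- The Hénon map `H_{a,b}(x,y) = (a - x² - b·y, x)` on `ℝ²`. -/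
def henon (a b : ℝ) (p : ℝ × ℝ) : ℝ × ℝ := (a - p.1 ^ 2 - b * p.2, p.1)

/-- `K^ℝ_{a,b}`: the set of points whose full orbit `{H^n(p) : n ∈ ℤ}` is bounded.
A full orbit through `p` is a sequence `o : ℤ → ℝ²` with `o 0 = p` and
`o (n+1) = H (o n)` for all `n ∈ ℤ`. -/
def henonK (a b : ℝ) : Set (ℝ × ℝ) :=
  {p | ∃ o : ℤ → ℝ × ℝ, o 0 = p ∧ (∀ n : ℤ, o (n + 1) = henon a b (o n)) ∧
    Bornology.IsBounded (Set.range o)}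

/-- The full 2-shift `Σ₂ = {0,1}^ℤ` (product topology, `{0,1}` discrete). -/
abbrev Sigma2 := ℤ → Fin 2

/-- The shift map `(σ s)_i = s_{i+1}`. -/
def shift (s : Sigma2) : Sigma2 := fun i => s (i + 1)

/-- The pruning pattern occurs in `s` at position `i` if `s_{i-1} = 1`, `s_{i+1} = 1`,
`s_{i-1-k} = 0` for `1 ≤ k ≤ N` and `s_{i+1+k} = 0` for `1 ≤ k ≤ M`. -/
def pattern (N M : ℕ) (s : Sigma2) (i : ℤ) : Prop :=
  s (i - 1) = 1 ∧ s (i + 1) = 1 ∧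
    (∀ k : ℕ, 1 ≤ k → k ≤ N → s (i - 1 - (k : ℤ)) = 0) ∧
    (∀ k : ℕ, 1 ≤ k → k ≤ M → s (i + 1 + (k : ℤ)) = 0)

open Classical in
/-- The pruning automorphism `ρ_{N,M}`: it flips coordinate `i` exactly when the
pruning pattern occurs in `s` at position `i`. -/
noncomputable def rho (N M : ℕ) (s : Sigma2) : Sigma2 :=
  fun i => if pattern N M s i then 1 - s i else s i

/-- The fixed-point set of `ρ_{N,M}`. -/
def fixSet (N M : ℕ) : Set Sigma2 := {s | rho N M s = s}

namespace HP

/-- strict evaluation -/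
noncomputable def force {α : Type} (x : ℕ) (f : ℕ → α) : α :=
  Nat.rec (motive := fun _ => α) (f 0) (fun m _ => f (Nat.succ m)) x

theorem force_eq {α : Type} (x : ℕ) (f : ℕ → α) : force x f = f x := by
  cases x <;> rfl

noncomputable def newton (n : ℕ) : ℕ :=
  Nat.rec (motive := fun _ => ℕ) 65536 (fun _ r => force r fun r => (r + n / r) / 2) 7

noncomputable def sd (t : ℕ) : ℕ :=
  force t fun t => force (newton t) fun r =>
    bif Nat.ble (r * r) t then r else
    bif Nat.ble ((r - 1) * (r - 1)) t then r - 1 else 0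

noncomputable def su (t : ℕ) : ℕ :=
  force t fun t => bif Nat.beq t 0 then 0 else force (newton t) fun r =>
    bif Nat.ble t (r * r) then r else
    bif Nat.ble t ((r + 1) * (r + 1)) then r + 1 else t

noncomputable def ent (t w : ℕ) : Option (ℕ × ℕ) :=
  force (t / 68719476736 ^ w % 68719476736) fun e =>
    bif Nat.beq e 0 then none else
    force (e / 262144) fun l => force (e % 262144) fun h => some (l, h)

def hull (a b : Option (ℕ × ℕ)) : Option (ℕ × ℕ) :=
  match a, b with
  | none, b => b
  | some a, none => some a
  | some (l, h), some (l', h') => some (bif Nat.ble l l' then l else l', bif Nat.ble h h' then h' else h)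

def tb (w i : ℕ) : Bool := Nat.beq (w / 2 ^ i % 2) 1

def crit (w : ℕ) : Bool := tb w 6 && (tb w 4 && !(tb w 3))

/-- `sd (S*(4*alo + 5*O) - S*(4*nh+ph))` -/
noncomputable def zd (alo nh ph : ℕ) : ℕ := sd (16384 * (4 * alo + 327680) - 16384 * (4 * nh + ph))
noncomputable def zu (ahi nl pl : ℕ) : ℕ := su (16384 * (4 * ahi + 327680) - 16384 * (4 * nl + pl))

noncomputable def plain (alo ahi nl nh pl ph : ℕ) : Option (Bool × ℕ × ℕ) :=
  bif Nat.ble (4 * nl + pl) (4 * ahi + 327680) then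
    force (zd alo nh ph) fun gl => force (zu ahi nl pl) fun gh => some (false, gl, gh)
  else none

noncomputable def kpf (q1 q2 : ℕ) : ℕ := force ((q1 + q2) / 4 + 1) fun r => bif Nat.ble 2560 r then r else 2560

/-- the critical evaluation -/
noncomputable def critE (alo ahi xl xh nl nh pl ph : ℕ) (fb : Option (Bool × ℕ × ℕ)) :
    Option (Bool × ℕ × ℕ) :=
  force (zd alo nh xh) fun X0 => force (zd alo xh ph) fun Y0 =>
  bif Nat.beq X0 0 then fb else bif Nat.beq Y0 0 then fb else
  force (kpf (268435456 / X0 + 1) (268435456 / Y0 + 1)) fun kp =>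
  force (65536 * ahi + 677642240 + 4 * (kp - 2560) * xh) fun a1 =>
  force (4 * kp * xl + 32768 * zd alo nh xl + 8192 * zd alo xl ph) fun b1 =>
  force (65536 * alo + 677642240 + 4 * (kp - 2560) * xl) fun a2 =>
  force (4 * kp * xh + 32768 * zu ahi nl xh + 8192 * zu ahi xh pl) fun b2 =>
  bif Nat.ble b1 a1 then
    force (sd (a2 - b2)) fun gl => force (su (a1 - b1)) fun gh => some (true, gl, gh)
  else none

noncomputable def nb1 (t w : ℕ) : Option (ℕ × ℕ) :=
  hull (ent t (w % 128 * 2)) (ent t (w % 128 * 2 + 1))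
noncomputable def pb1 (t w : ℕ) : Option (ℕ × ℕ) :=
  hull (ent t (w / 2)) (ent t (w / 2 + 128))
noncomputable def nb2 (t w : ℕ) : Option (ℕ × ℕ) :=
  hull (hull (ent t (w % 64 * 4)) (ent t (w % 64 * 4 + 1)))
    (hull (ent t (w % 64 * 4 + 2)) (ent t (w % 64 * 4 + 3)))
noncomputable def pb2 (t w : ℕ) : Option (ℕ × ℕ) :=
  hull (hull (ent t (w / 4)) (ent t (w / 4 + 64)))
    (hull (ent t (w / 4 + 128)) (ent t (w / 4 + 192)))

noncomputable def fpl (alo ahi t w : ℕ) : Option (Bool × ℕ × ℕ) :=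
  match nb1 t w, pb1 t w with
  | some (nl, nh), some (pl, ph) => plain alo ahi nl nh pl ph
  | _, _ => none

noncomputable def core (alo ahi t w xl xh : ℕ) : Option (Bool × ℕ × ℕ) :=
  bif crit w then
    match nb2 t w, pb2 t w with
    | some (nl, nh), some (pl, ph) => critE alo ahi xl xh nl nh pl ph (fpl alo ahi t w)
    | _, _ => none
  else fpl alo ahi t w

/-- lower end -/
def outl (e c : Bool) (gl gh : ℕ) : ℕ :=
  bif c then
    bif e then bif Nat.ble (2560 + 1) gl then (133632 + gl) / 2 else 65536
    else (133632 - gh) / 2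
  else bif e then 65536 + gl / 2 else 65536 - (gh + 1) / 2

/-- upper end -/
def outh (e c : Bool) (gl gh : ℕ) : ℕ :=
  bif c then
    bif e then (133632 + gh + 1) / 2 else (133632 - gl + 1) / 2
  else bif e then 65536 + (gh + 1) / 2 else 65536 - gl / 2

noncomputable def newent (alo ahi t w : ℕ) : ℕ :=
  match ent t w with
  | none => 0
  | some (xl, xh) =>
    match core alo ahi t w xl xh with
    | none => 0
    | some (c, gl, gh) =>
      force (max (outl (tb w 5) c gl gh) xl) fun l => force (min (outh (tb w 5) c gl gh) xh) fun h =>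
      bif Nat.ble l h then l * 262144 + h else 0

noncomputable def pack (f : ℕ → ℕ) (n : ℕ) : ℕ :=
  Nat.rec (motive := fun _ => ℕ) 0 (fun m r => f (255 - m) % 68719476736 + 68719476736 * r) n

noncomputable def ini0 : ℕ :=
  pack (fun w => bif tb w 5 then 65536 * 262144 + 104857 else 26215 * 262144 + 65536) 256

noncomputable def iter (alo ahi n : ℕ) : ℕ :=
  Nat.rec (motive := fun _ => ℕ) ini0
    (fun _ r => force r fun t => pack (fun w => force w fun w => newent alo ahi t w) 256) n

def forb1 (w i : ℕ) : Bool := tb w (i+4) && (tb w (i+2) && (!(tb w (i+1)) && !(tb w i)))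
def forb (w : ℕ) : Bool := forb1 w 3 || (forb1 w 2 || (forb1 w 1 || forb1 w 0))

def W5 (i : ℕ) : ℕ := 99830874219821549293107002372105007863506684284254393948813546317621974061760744295389874763931767790044200451735528900264036 / 8192 ^ i % 8192
def WT (w : ℕ) : ℕ := W5 (w / 4 % 32)

def lipP (g w : ℕ) : Bool :=
  Nat.ble (16384 * (64 * W5 (w / 2 % 32) + 17 * W5 (w / 8 % 32))) (56 * g * WT w)

noncomputable def lipC (alo ahi xl xh nl nh pl ph g w : ℕ) : Bool :=
  force (zd alo nh xh) fun X0 => force (zd alo xh ph) fun Y0 =>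
  force (zu ahi nl xl) fun X1 => force (zu ahi xl pl) fun Y1 =>
  bif Nat.beq X0 0 then false else bif Nat.beq Y0 0 then false else
  bif Nat.beq X1 0 then false else bif Nat.beq Y1 0 then false else
  force (268435456 / X0 + 1) fun q1 => force (268435456 / Y0 + 1) fun q2 =>
  force (257 * (q1 + q2) - 2621440) fun d1 =>
  force (2621440 - 255 * (268435456 / X1 + 268435456 / Y1)) fun d2 =>
  force ((d1 + d2) / 256 + 1) fun D =>
  Nat.ble (64 * (D * WT w + 4 * q1 * W5 (w % 32)) + 17 * q2 * W5 (w / 16)) (224 * g * WT w) &&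
  Nat.ble (64 * (D * WT w + 4 * q1 * W5 (w % 32)) + 17 * q2 * W5 (w / 16 + 16)) (224 * g * WT w)

noncomputable def lip (alo ahi t w xl xh g : ℕ) (c : Bool) : Bool :=
  bif c then
    match nb2 t w, pb2 t w with
    | some (nl, nh), some (pl, ph) => lipC alo ahi xl xh nl nh pl ph g w
    | _, _ => false
  else lipP g w

noncomputable def okw (alo ahi t w : ℕ) : Bool :=
  bif forb w then (match ent t w with | none => true | some _ => false)
  else match ent t w with
  | none => false
  | some (xl, xh) =>
    match core alo ahi t w xl xh with
    | none => false
    | some (c, gl, gh) =>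
      (c == crit w) && (Nat.ble xl xh && (Nat.ble 26215 xl && (Nat.ble xh 104857 &&
      (Nat.ble xl (outl (tb w 5) c gl gh) && (Nat.ble (outh (tb w 5) c gl gh) xh &&
      (Nat.ble 1 gl && ((bif tb w 5 then Nat.ble 65537 xl else Nat.ble xh 65535) &&
      ((bif c && tb w 5 then Nat.ble 2561 gl else true) &&
      (Nat.ble 1 (WT w) && lip alo ahi t w xl xh gl c)))))))))

noncomputable def okall (alo ahi t n : ℕ) : Bool :=
  Nat.rec (motive := fun _ => Bool) true (fun m r => okw alo ahi t m && r) n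

noncomputable def check (alo ahi : ℕ) : Bool :=
  force (iter alo ahi 11) fun t => okall alo ahi t 256

theorem sd_sq (t : ℕ) : sd t * sd t ≤ t := by
  unfold sd
  simp only [force_eq]
  generalize newton t = r
  cases h : Nat.ble (r * r) t <;> simp only [cond_true, cond_false]
  · cases h' : Nat.ble ((r - 1) * (r - 1)) t <;> simp only [cond_true, cond_false]
    · simp
    · exact Nat.le_of_ble_eq_true h'
  · exact Nat.le_of_ble_eq_true h

theorem su_sq (t : ℕ) : t ≤ su t * su t := by
  unfold su
  simp only [force_eq]
  generalize newton t = r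
  cases h0 : Nat.beq t 0 <;> simp only [cond_true, cond_false]
  · cases h : Nat.ble t (r * r) <;> simp only [cond_true, cond_false]
    · cases h' : Nat.ble t ((r + 1) * (r + 1)) <;> simp only [cond_true, cond_false]
      · exact Nat.le_mul_self t
      · exact Nat.le_of_ble_eq_true h'
    · exact Nat.le_of_ble_eq_true h
  · have := Nat.eq_of_beq_eq_true h0
    omega

theorem sd_sound {A B : ℕ} {z : ℝ} (h : (A : ℝ) - B ≤ z) : (sd (A - B) : ℝ) ≤ √z := by
  rcases le_total A B with hAB | hAB
  · have h1 := sd_sq (A - B)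
    rw [Nat.sub_eq_zero_of_le hAB] at h1 ⊢
    have : sd 0 = 0 := by nlinarith
    rw [this]; simp
  · apply Real.le_sqrt_of_sq_le
    have h1 : ((sd (A - B) * sd (A - B) : ℕ) : ℝ) ≤ ((A - B : ℕ) : ℝ) := by exact_mod_cast sd_sq _
    rw [Nat.cast_sub hAB] at h1
    push_cast at h1
    nlinarith

theorem su_sound {A B : ℕ} {z : ℝ} (h : z ≤ (A : ℝ) - B) : √z ≤ (su (A - B) : ℝ) := by
  rcases le_total A B with hAB | hAB
  · have : z ≤ 0 := by
      have : (A : ℝ) ≤ B := by exact_mod_cast hAB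
      linarith
    rw [Real.sqrt_eq_zero_of_nonpos this]; positivity
  · apply Real.sqrt_le_iff.2 ⟨by positivity, _⟩
    have h1 : ((A - B : ℕ) : ℝ) ≤ ((su (A - B) * su (A - B) : ℕ) : ℝ) := by exact_mod_cast su_sq _
    rw [Nat.cast_sub hAB] at h1
    push_cast at h1
    nlinarith

theorem sqrt_diff {p q m : ℝ} (hm : 0 < m) (hq : m ≤ √q) (hpq : q ≤ p) :
    √p - √q ≤ (p - q) / (2 * m) := by
  have hq0 : 0 < q := Real.sqrt_pos.1 (lt_of_lt_of_le hm hq)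
  have h1 := Real.sq_sqrt hq0.le
  have h2 := Real.sq_sqrt (hq0.le.trans hpq)
  have h3 := Real.sqrt_le_sqrt hpq
  rw [le_div_iff₀ (by positivity)]
  nlinarith

theorem sqrt_diff' {p q m : ℝ} (hm : 0 < m) (hp : √p ≤ m) (hq0 : 0 ≤ q) (hpq : q ≤ p) :
    (p - q) / (2 * m) ≤ √p - √q := by
  have h1 := Real.sq_sqrt hq0
  have h2 := Real.sq_sqrt (hq0.trans hpq)
  have h3 := Real.sqrt_le_sqrt hpq
  rw [div_le_iff₀ (by positivity)]
  nlinarith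

theorem sqrt_diff_abs {p q m : ℝ} (hm : 0 < m) (hp : m ≤ √p) (hq : m ≤ √q) :
    |√p - √q| ≤ |p - q| / (2 * m) := by
  rcases le_total q p with h | h
  · rw [abs_of_nonneg (sub_nonneg.2 (Real.sqrt_le_sqrt h)), abs_of_nonneg (sub_nonneg.2 h)]
    exact sqrt_diff hm hq h
  · rw [abs_sub_comm, abs_sub_comm p, abs_of_nonneg (sub_nonneg.2 (Real.sqrt_le_sqrt h)),
      abs_of_nonneg (sub_nonneg.2 h)]
    exact sqrt_diff hm hp h

/-- admissible parameters for a sub-range -/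
structure Par (alo ahi : ℕ) (a b : ℝ) : Prop where
  lo : ∀ t : ℝ, |t| ≤ 39321 → 4 * (alo : ℝ) ≤ 65536 * a - (4 * b - 1) * t
  hi : ∀ t : ℝ, |t| ≤ 39321 → 65536 * a - (4 * b - 1) * t ≤ 4 * (ahi : ℝ)
  blo : 255 / 256 ≤ 4 * b
  bhi : 4 * b ≤ 257 / 256
  ahi_le : ahi ≤ 37634

noncomputable def pz (a b N P : ℝ) : ℝ := 16384 * (65536 * a - 4 * N - 4 * b * P)

noncomputable def cG (a b u N P : ℝ) : ℝ :=
  1073741824 * a + 6553600 - 10240 * u - 32768 * √(pz a b N u) - 32768 * b * √(pz a b u P)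

theorem pz_lo {alo ahi : ℕ} {a b N P : ℝ} (hp : Par alo ahi a b) {nh ph : ℕ}
    (hN : N + 65536 ≤ nh) (hP : P + 65536 ≤ ph) (hPR : |P| ≤ 39321) :
    (zd alo nh ph : ℝ) ≤ √(pz a b N P) := by
  apply sd_sound
  have := hp.lo P hPR
  unfold pz; push_cast
  nlinarith

theorem pz_hi' {alo ahi : ℕ} {a b N P : ℝ} (hp : Par alo ahi a b) {nl pl : ℕ}
    (hN : nl ≤ N + 65536) (hP : pl ≤ P + 65536) (hPR : |P| ≤ 39321) :
    pz a b N P ≤ ((16384 * (4 * ahi + 327680) : ℕ) : ℝ) - ((16384 * (4 * nl + pl) : ℕ) : ℝ) := by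
  have := hp.hi P hPR
  unfold pz; push_cast
  nlinarith

theorem pz_hi {alo ahi : ℕ} {a b N P : ℝ} (hp : Par alo ahi a b) {nl pl : ℕ}
    (hN : nl ≤ N + 65536) (hP : pl ≤ P + 65536) (hPR : |P| ≤ 39321) :
    √(pz a b N P) ≤ (zu ahi nl pl : ℝ) :=
  su_sound (pz_hi' hp hN hP hPR)

/-- membership in an encoded interval -/
def In (o : Option (ℕ × ℕ)) (u : ℝ) : Prop :=
  ∃ l h : ℕ, o = some (l, h) ∧ (l : ℝ) ≤ u + 65536 ∧ u + 65536 ≤ h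

theorem In.hull_left {o o' : Option (ℕ × ℕ)} {u : ℝ} (h : In o u) : In (hull o o') u := by
  obtain ⟨l, h, rfl, h1, h2⟩ := h
  rcases o' with _ | ⟨l', h'⟩
  · exact ⟨l, h, rfl, h1, h2⟩
  · refine ⟨_, _, rfl, ?_, ?_⟩
    · cases hb : Nat.ble l l' <;> simp only [cond_true, cond_false]
      · have : ¬ l ≤ l' := fun hh => by simp [Nat.ble_eq_true_of_le hh] at hb
        have : (l' : ℝ) ≤ l := by exact_mod_cast (by omega : l' ≤ l)
        linarith
      · exact h1
    · cases hb : Nat.ble h h' <;> simp only [cond_true, cond_false]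
      · exact h2
      · have : (h : ℝ) ≤ h' := by exact_mod_cast Nat.le_of_ble_eq_true hb
        linarith

theorem In.hull_right {o o' : Option (ℕ × ℕ)} {u : ℝ} (h : In o' u) : In (hull o o') u := by
  obtain ⟨l, h, rfl, h1, h2⟩ := h
  rcases o with _ | ⟨l', h'⟩
  · exact ⟨l, h, rfl, h1, h2⟩
  · refine ⟨_, _, rfl, ?_, ?_⟩
    · cases hb : Nat.ble l' l <;> simp only [cond_true, cond_false]
      · exact h1
      · have : (l' : ℝ) ≤ l := by exact_mod_cast Nat.le_of_ble_eq_true hb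
        linarith
    · cases hb : Nat.ble h' h <;> simp only [cond_true, cond_false]
      · have : ¬ h' ≤ h := fun hh => by simp [Nat.ble_eq_true_of_le hh] at hb
        have : (h : ℝ) ≤ h' := by exact_mod_cast (by omega : h ≤ h')
        linarith
      · exact h2

theorem ble_false {m n : ℕ} (h : Nat.ble m n = false) : n < m := by
  by_contra hh
  simp [Nat.ble_eq_true_of_le (not_lt.1 hh)] at h

theorem plain_none {alo ahi : ℕ} {a b N P : ℝ} (hp : Par alo ahi a b) {nl nh pl ph : ℕ}
    (hN : nl ≤ N + 65536) (hP : pl ≤ P + 65536) (hPR : |P| ≤ 39321)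
    (h : plain alo ahi nl nh pl ph = none) : pz a b N P < 0 := by
  unfold plain at h
  simp only [force_eq] at h
  cases hb : Nat.ble (4 * nl + pl) (4 * ahi + 327680) <;> rw [hb] at h
  · have h1 := ble_false hb
    have h2 := pz_hi' hp hN hP hPR
    have h3 : ((4 * ahi + 327680 : ℕ) : ℝ) < ((4 * nl + pl : ℕ) : ℝ) := by exact_mod_cast h1
    push_cast at h2 h3
    linarith
  · simp at h

theorem plain_some {alo ahi : ℕ} {a b N P : ℝ} (hp : Par alo ahi a b) {nl nh pl ph : ℕ}
    (hN : nl ≤ N + 65536) (hP : pl ≤ P + 65536)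
    (hN' : N + 65536 ≤ nh) (hP' : P + 65536 ≤ ph) (hPR : |P| ≤ 39321) {c : Bool} {gl gh : ℕ}
    (h : plain alo ahi nl nh pl ph = some (c, gl, gh)) :
    c = false ∧ (gl : ℝ) ≤ √(pz a b N P) ∧ √(pz a b N P) ≤ gh := by
  unfold plain at h
  simp only [force_eq] at h
  cases hb : Nat.ble (4 * nl + pl) (4 * ahi + 327680) <;> rw [hb] at h
  · simp at h
  · simp only [cond_true, Option.some.injEq, Prod.mk.injEq] at h
    obtain ⟨rfl, rfl, rfl⟩ := h
    exact ⟨rfl, pz_lo hp hN' hP' hPR, pz_hi hp hN hP hPR⟩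

theorem kpf_spec (q1 q2 : ℕ) : q1 + q2 ≤ 4 * kpf q1 q2 ∧ 2560 ≤ kpf q1 q2 := by
  unfold kpf
  simp only [force_eq]
  cases h : Nat.ble 2560 ((q1 + q2) / 4 + 1) <;> simp only [cond_true, cond_false]
  · have := ble_false h
    omega
  · have := Nat.le_of_ble_eq_true h
    omega

theorem div_q (X : ℕ) (hX : X ≠ 0) : (268435456 : ℝ) / X ≤ ((268435456 / X + 1 : ℕ) : ℝ) := by
  have h0 : 0 < X := Nat.pos_of_ne_zero hX
  rw [div_le_iff₀ (by exact_mod_cast h0)]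
  have := Nat.lt_div_mul_add (a := 268435456) h0
  have h2 : 268435456 ≤ (268435456 / X + 1) * X := by nlinarith
  exact_mod_cast h2

theorem div_q' (X : ℕ) : ((268435456 / X : ℕ) : ℝ) ≤ (268435456 : ℝ) / X := by
  exact_mod_cast @Nat.cast_div_le ℝ _ _ _ 268435456 X
theorem cond_f {α : Type} {c : Bool} (h : c = false) (x y : α) : cond c x y = y := by rw [h]; rfl
theorem cond_t {α : Type} {c : Bool} (h : c = true) (x y : α) : cond c x y = x := by rw [h]; rfl

theorem slopeX {A N v w m q : ℝ} (hm : 0 < m) (hq : 268435456 / m ≤ q) (hvw : v ≤ w)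
    (h : m ≤ √(16384 * (A - 4 * N - w))) :
    32768 * (√(16384 * (A - 4 * N - v)) - √(16384 * (A - 4 * N - w))) ≤ q * (w - v) := by
  have h1 := sqrt_diff (p := 16384 * (A - 4 * N - v)) hm h (by linarith)
  have h2 : 268435456 / m * (w - v) ≤ q * (w - v) :=
    mul_le_mul_of_nonneg_right hq (by linarith)
  have h3 : 32768 * ((16384 * (A - 4 * N - v) - 16384 * (A - 4 * N - w)) / (2 * m)) =
    268435456 / m * (w - v) := by field_simp; ring
  linarith

theorem slopeY {A P v w m q : ℝ} (hm : 0 < m) (hq : 268435456 / m ≤ q) (hvw : v ≤ w)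
    (h : m ≤ √(16384 * (A - 4 * w - P))) :
    8192 * (√(16384 * (A - 4 * v - P)) - √(16384 * (A - 4 * w - P))) ≤ q * (w - v) := by
  have h1 := sqrt_diff (p := 16384 * (A - 4 * v - P)) hm h (by linarith)
  have h2 : 268435456 / m * (w - v) ≤ q * (w - v) :=
    mul_le_mul_of_nonneg_right hq (by linarith)
  have h3 : 8192 * ((16384 * (A - 4 * v - P) - 16384 * (A - 4 * w - P)) / (2 * m)) =
    268435456 / m * (w - v) := by field_simp; ring
  linarith

theorem critE_spec {alo ahi : ℕ} {a b u N P : ℝ} (hp : Par alo ahi a b) {xl xh nl nh pl ph : ℕ}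
    (hx : xl ≤ u + 65536) (hx' : u + 65536 ≤ xh)
    (hN : nl ≤ N + 65536) (hP : pl ≤ P + 65536)
    (hN' : N + 65536 ≤ nh) (hP' : P + 65536 ≤ ph) (huR : |u| ≤ 39321) (hPR : |P| ≤ 39321)
    (fb : Option (Bool × ℕ × ℕ)) :
    critE alo ahi xl xh nl nh pl ph fb = fb ∨
    (critE alo ahi xl xh nl nh pl ph fb = none ∧ cG a b u N P < 0) ∨
    ∃ gl gh : ℕ, critE alo ahi xl xh nl nh pl ph fb = some (true, gl, gh) ∧
      (gl : ℝ) ≤ √(cG a b u N P) ∧ √(cG a b u N P) ≤ gh := by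
  unfold critE
  simp only [force_eq]
  rcases hX : Nat.beq (zd alo nh xh) 0 with _ | _
  swap
  · left; exact cond_t rfl _ _
  rcases hY : Nat.beq (zd alo xh ph) 0 with _ | _
  swap
  · left; rw [cond_f rfl]; exact cond_t rfl _ _
  rw [cond_f rfl, cond_f rfl]
  have hX0 : zd alo nh xh ≠ 0 := fun h => by simp [h] at hX
  have hY0 : zd alo xh ph ≠ 0 := fun h => by simp [h] at hY
  right
  set A1 : ℝ := 65536 * a - (4 * b - 1) * u with hA1
  set A2 : ℝ := 65536 * a - (4 * b - 1) * P with hA2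
  have e1 : pz a b N u = 16384 * (A1 - 4 * N - u) := by rw [hA1]; unfold pz; ring
  have e2 : pz a b u P = 16384 * (A2 - 4 * u - P) := by rw [hA2]; unfold pz; ring
  have a1l := hp.lo u huR
  have a1h := hp.hi u huR
  have a2l := hp.lo P hPR
  have a2h := hp.hi P hPR
  rw [← hA1] at a1l a1h
  rw [← hA2] at a2l a2h
  have hXm : (zd alo nh xh : ℝ) ≤ √(16384 * (A1 - 4 * N - (xh - 65536))) :=
    sd_sound (by push_cast; linarith)
  have hYm : (zd alo xh ph : ℝ) ≤ √(16384 * (A2 - 4 * (xh - 65536) - P)) :=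
    sd_sound (by push_cast; linarith)
  have hXu : (zd alo nh xh : ℝ) ≤ √(16384 * (A1 - 4 * N - u)) :=
    sd_sound (by push_cast; linarith)
  have hYu : (zd alo xh ph : ℝ) ≤ √(16384 * (A2 - 4 * u - P)) :=
    sd_sound (by push_cast; linarith)
  have hXl : (zd alo nh xl : ℝ) ≤ √(16384 * (A1 - 4 * N - (xl - 65536))) :=
    sd_sound (by push_cast; linarith)
  have hYl : (zd alo xl ph : ℝ) ≤ √(16384 * (A2 - 4 * (xl - 65536) - P)) :=
    sd_sound (by push_cast; linarith)
  have hXh : √(16384 * (A1 - 4 * N - (xh - 65536))) ≤ (zu ahi nl xh : ℝ) :=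
    su_sound (by push_cast; linarith)
  have hYh : √(16384 * (A2 - 4 * (xh - 65536) - P)) ≤ (zu ahi xh pl : ℝ) :=
    su_sound (by push_cast; linarith)
  have hX0' : (0 : ℝ) < zd alo nh xh := by exact_mod_cast Nat.pos_of_ne_zero hX0
  have hY0' : (0 : ℝ) < zd alo xh ph := by exact_mod_cast Nat.pos_of_ne_zero hY0
  have q1 := div_q _ hX0
  have q2 := div_q _ hY0
  have hk := kpf_spec (268435456 / zd alo nh xh + 1) (268435456 / zd alo xh ph + 1)
  generalize (268435456 / zd alo nh xh + 1) = Q1 at *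
  generalize (268435456 / zd alo xh ph + 1) = Q2 at *
  generalize kpf Q1 Q2 = kp at *
  obtain ⟨hk1, hk2⟩ := hk
  have hk1' : (Q1 : ℝ) + Q2 ≤ 4 * kp := by exact_mod_cast hk1
  have s1 := slopeX hX0' q1 (by linarith : (xl : ℝ) - 65536 ≤ u) hXu
  have s2 := slopeY hY0' q2 (by linarith : (xl : ℝ) - 65536 ≤ u) hYu
  have s3 := slopeX hX0' q1 (by linarith : u ≤ (xh : ℝ) - 65536) hXm
  have s4 := slopeY hY0' q2 (by linarith : u ≤ (xh : ℝ) - 65536) hYm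
  rw [← e1] at s1 s3
  rw [← e2] at s2 s4
  have hYR : √(pz a b u P) ≤ 78642 := by
    apply Real.sqrt_le_iff.2 ⟨by norm_num, _⟩
    rw [e2]
    have h1 := abs_le.1 huR
    have h2 := abs_le.1 hPR
    have h3 : (ahi : ℝ) ≤ 37634 := by exact_mod_cast hp.ahi_le
    linarith
  have hY2 : |√(pz a b u P) / 2| ≤ 39321 := by
    rw [abs_of_nonneg (by positivity)]; linarith
  have a3l := hp.lo _ hY2
  have a3h := hp.hi _ hY2
  have m1 : (Q1 + Q2) * (u - ((xl : ℝ) - 65536)) ≤ 4 * kp * (u - ((xl : ℝ) - 65536)) :=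
    mul_le_mul_of_nonneg_right hk1' (by linarith)
  have m2 : (Q1 + Q2) * ((xh : ℝ) - 65536 - u) ≤ 4 * kp * ((xh : ℝ) - 65536 - u) :=
    mul_le_mul_of_nonneg_right hk1' (by linarith)
  have hkr : (0 : ℝ) ≤ (kp : ℝ) - 2560 := by
    have : (2560 : ℝ) ≤ kp := by exact_mod_cast hk2
    linarith
  have m3 := mul_le_mul_of_nonneg_left (by linarith : u ≤ (xh : ℝ) - 65536) hkr
  have m4 := mul_le_mul_of_nonneg_left (by linarith : (xl : ℝ) - 65536 ≤ u) hkr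
  have ub : cG a b u N P ≤ ((65536 * ahi + 677642240 + 4 * (kp - 2560) * xh : ℕ) : ℝ) -
      ((4 * kp * xl + 32768 * zd alo nh xl + 8192 * zd alo xl ph : ℕ) : ℝ) := by
    push_cast [Nat.cast_sub hk2]
    unfold cG
    linarith
  have lb : ((65536 * alo + 677642240 + 4 * (kp - 2560) * xl : ℕ) : ℝ) -
      ((4 * kp * xh + 32768 * zu ahi nl xh + 8192 * zu ahi xh pl : ℕ) : ℝ) ≤ cG a b u N P := by
    push_cast [Nat.cast_sub hk2]
    unfold cG
    linarith
  generalize (65536 * ahi + 677642240 + 4 * (kp - 2560) * xh) = a1 at *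
  generalize (4 * kp * xl + 32768 * zd alo nh xl + 8192 * zd alo xl ph) = b1 at *
  rcases hb : Nat.ble b1 a1 with _ | _
  · left
    refine ⟨cond_f rfl _ _, ?_⟩
    have : (a1 : ℝ) < b1 := by exact_mod_cast ble_false hb
    linarith
  · right
    exact ⟨_, _, cond_t rfl _ _, sd_sound lb, su_sound ub⟩
theorem half_le (x : ℕ) : ((x / 2 : ℕ) : ℝ) ≤ (x : ℝ) / 2 := by
  have h : 2 * (x / 2) ≤ x := by omega
  have : (2 : ℝ) * ((x / 2 : ℕ) : ℝ) ≤ x := by exact_mod_cast h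
  linarith

theorem le_half (x : ℕ) : (x : ℝ) / 2 ≤ (((x + 1) / 2 : ℕ) : ℝ) := by
  have h : x ≤ 2 * ((x + 1) / 2) := by omega
  have : (x : ℝ) ≤ (2 : ℝ) * (((x + 1) / 2 : ℕ) : ℝ) := by exact_mod_cast h
  linarith

theorem sub_le' (x y : ℕ) : (x : ℝ) - y ≤ ((x - y : ℕ) : ℝ) := by
  have h : x ≤ (x - y) + y := by omega
  have : (x : ℝ) ≤ ((x - y : ℕ) : ℝ) + y := by exact_mod_cast h
  linarith

theorem sub_cases (x y : ℕ) : x - y = 0 ∨ ((x - y : ℕ) : ℝ) = x - y := by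
  rcases le_total x y with h | h
  · left; omega
  · right; exact Nat.cast_sub h

theorem out_plain {e : Bool} {gl gh : ℕ} {g u : ℝ} (h1 : gl ≤ g) (h2 : g ≤ gh)
    (hu : 2 * u = bif e then g else -g) (h0 : 0 ≤ u + 65536 ∨ 0 < outl e false gl gh) :
    (outl e false gl gh : ℝ) ≤ u + 65536 ∧ u + 65536 ≤ outh e false gl gh := by
  have a1 := half_le gl
  have a2 := le_half gh
  cases e
  · rw [cond_false] at hu
    have el : outl false false gl gh = 65536 - (gh + 1) / 2 := rfl
    have eh : outh false false gl gh = 65536 - gl / 2 := rfl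
    rw [el] at h0 ⊢
    rw [eh]
    have a3 := sub_le' 65536 (gl / 2)
    push_cast at a3
    constructor
    · rcases sub_cases 65536 ((gh + 1) / 2) with h | h
      · rw [h] at h0 ⊢
        simpa using h0
      · rw [h]; push_cast at a2 ⊢; linarith
    · linarith
  · rw [cond_true] at hu
    have el : outl true false gl gh = 65536 + gl / 2 := rfl
    have eh : outh true false gl gh = 65536 + (gh + 1) / 2 := rfl
    rw [el, eh]
    push_cast at a1 a2 ⊢
    constructor <;> linarith

theorem out_crit {e : Bool} {gl gh : ℕ} {g u : ℝ} (h1 : gl ≤ g) (h2 : g ≤ gh)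
    (hu : 2 * u = 2560 + bif e then g else -g) (h0 : 0 ≤ u + 65536 ∨ 0 < outl e true gl gh) :
    (outl e true gl gh : ℝ) ≤ u + 65536 ∧ u + 65536 ≤ outh e true gl gh := by
  have hg : (0 : ℝ) ≤ gl := by positivity
  cases e
  · rw [cond_false] at hu
    have el : outl false true gl gh = (133632 - gh) / 2 := rfl
    have eh : outh false true gl gh = (133632 - gl + 1) / 2 := rfl
    rw [el] at h0 ⊢
    rw [eh]
    have a3 := sub_le' 133632 gl
    have a4 := le_half (133632 - gl)
    have a5 := half_le (133632 - gh)
    push_cast at a3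
    constructor
    · rcases sub_cases 133632 gh with h | h
      · rw [h] at h0 ⊢
        simpa using h0
      · rw [h] at a5; push_cast at a5; push_cast; linarith
    · linarith
  · rw [cond_true] at hu
    have eh : outh true true gl gh = (133632 + gh + 1) / 2 := rfl
    rw [eh]
    have a4 := le_half (133632 + gh)
    have a5 := half_le (133632 + gl)
    push_cast at a4 a5 ⊢
    refine ⟨?_, by linarith⟩
    have el : outl true true gl gh = bif Nat.ble (2560 + 1) gl then (133632 + gl) / 2 else 65536 := rfl
    rw [el]
    rcases hb : Nat.ble (2560 + 1) gl with _ | _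
    · rw [cond_f rfl]; push_cast; linarith
    · rw [cond_t rfl]; push_cast; linarith

/-- crit case for an orbit: only the square is known -/
theorem out_crit' {e : Bool} {gl gh : ℕ} {u G : ℝ} (h1 : gl ≤ √G) (h2 : √G ≤ gh)
    (hu : (2 * u - 2560) ^ 2 = G) (he : e = true → 0 ≤ u) (he' : e = false → u ≤ 0)
    (h0 : 0 ≤ u + 65536) :
    (outl e true gl gh : ℝ) ≤ u + 65536 ∧ u + 65536 ≤ outh e true gl gh := by
  have hs : √G = |2 * u - 2560| := by rw [← hu, Real.sqrt_sq_eq_abs]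
  cases e
  · apply out_crit h1 h2 _ (Or.inl h0)
    rw [hs, abs_of_neg (by linarith [he' rfl]), cond_false]; ring
  · rcases le_total 0 (2 * u - 2560) with h | h
    · apply out_crit h1 h2 _ (Or.inl h0)
      rw [hs, abs_of_nonneg h, cond_true]; ring
    · have hu0 := he rfl
      have h3 : √G = 2560 - 2 * u := by rw [hs, abs_of_nonpos h]; ring
      have eh : outh true true gl gh = (133632 + gh + 1) / 2 := rfl
      have el : outl true true gl gh = bif Nat.ble (2560 + 1) gl then (133632 + gl) / 2 else 65536 := rfl
      rw [eh, el]
      have a4 := le_half (133632 + gh)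
      have hg : (0 : ℝ) ≤ gh := by positivity
      push_cast at a4 ⊢
      refine ⟨?_, by linarith⟩
      rcases hb : Nat.ble (2560 + 1) gl with _ | _
      · rw [cond_f rfl]; push_cast; linarith
      · exfalso
        have : (2561 : ℝ) ≤ gl := by exact_mod_cast Nat.le_of_ble_eq_true hb
        linarith

theorem tb_iff (w i : ℕ) : tb w i = true ↔ w / 2 ^ i % 2 = 1 := by
  unfold tb; exact Nat.beq_eq ▸ Iff.rfl

theorem tb_false (w i : ℕ) : tb w i = false ↔ w / 2 ^ i % 2 = 0 := by
  rw [← Bool.not_eq_true, tb_iff]; omega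

/-- word at `n` -/
def wd (s : ℤ → Fin 2) (n : ℤ) : ℕ :=
  128 * (s (n - 2)).val + 64 * (s (n - 1)).val + 32 * (s n).val + 16 * (s (n + 1)).val +
  8 * (s (n + 2)).val + 4 * (s (n + 3)).val + 2 * (s (n + 4)).val + (s (n + 5)).val

theorem wd_lt (s : ℤ → Fin 2) (n : ℤ) : wd s n < 256 := by
  unfold wd; omega

theorem wd_tb5 (s : ℤ → Fin 2) (n : ℤ) : wd s n / 2 ^ 5 % 2 = (s n).val := by
  unfold wd; omega
theorem wd_tb6 (s : ℤ → Fin 2) (n : ℤ) : wd s n / 2 ^ 6 % 2 = (s (n - 1)).val := by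
  unfold wd; omega
theorem wd_tb4 (s : ℤ → Fin 2) (n : ℤ) : wd s n / 2 ^ 4 % 2 = (s (n + 1)).val := by
  unfold wd; omega
theorem wd_tb3 (s : ℤ → Fin 2) (n : ℤ) : wd s n / 2 ^ 3 % 2 = (s (n + 2)).val := by
  unfold wd; omega

theorem tb5_t (s : ℤ → Fin 2) (n : ℤ) : tb (wd s n) 5 = true ↔ s n = 1 := by
  rw [tb_iff, wd_tb5]; omega
theorem tb5_f (s : ℤ → Fin 2) (n : ℤ) : tb (wd s n) 5 = false ↔ s n = 0 := by
  rw [tb_false, wd_tb5]; omega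

theorem crit_iff (s : ℤ → Fin 2) (n : ℤ) :
    crit (wd s n) = true ↔ s (n - 1) = 1 ∧ s (n + 1) = 1 ∧ s (n + 2) = 0 := by
  unfold crit
  rw [Bool.and_eq_true, Bool.and_eq_true, Bool.not_eq_true', tb_iff, tb_iff, tb_false, wd_tb6, wd_tb4,
    wd_tb3]
  omega

theorem wd_succ (s : ℤ → Fin 2) (n : ℤ) :
    wd s (n + 1) = wd s n % 128 * 2 + (s (n + 6)).val := by
  unfold wd
  rw [show n + 1 - 2 = n - 1 by ring, show n + 1 - 1 = n by ring, show n + 1 + 1 = n + 2 by ring,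
    show n + 1 + 2 = n + 3 by ring, show n + 1 + 3 = n + 4 by ring, show n + 1 + 4 = n + 5 by ring,
    show n + 1 + 5 = n + 6 by ring]
  omega

theorem wd_pred (s : ℤ → Fin 2) (n : ℤ) :
    wd s (n - 1) = wd s n / 2 + 128 * (s (n - 3)).val := by
  unfold wd
  rw [show n - 1 - 2 = n - 3 by ring, show n - 1 - 1 = n - 2 by ring, show n - 1 + 1 = n by ring,
    show n - 1 + 2 = n + 1 by ring, show n - 1 + 3 = n + 2 by ring, show n - 1 + 4 = n + 3 by ring,
    show n - 1 + 5 = n + 4 by ring]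
  omega

theorem wd_succ2 (s : ℤ → Fin 2) (n : ℤ) :
    wd s (n + 2) = wd s n % 64 * 4 + 2 * (s (n + 6)).val + (s (n + 7)).val := by
  unfold wd
  rw [show n + 2 - 2 = n by ring, show n + 2 - 1 = n + 1 by ring, show n + 2 + 1 = n + 3 by ring,
    show n + 2 + 2 = n + 4 by ring, show n + 2 + 3 = n + 5 by ring, show n + 2 + 4 = n + 6 by ring,
    show n + 2 + 5 = n + 7 by ring]
  omega

theorem wd_pred2 (s : ℤ → Fin 2) (n : ℤ) :
    wd s (n - 2) = wd s n / 4 + 64 * (s (n - 3)).val + 128 * (s (n - 4)).val := by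
  unfold wd
  rw [show n - 2 - 2 = n - 4 by ring, show n - 2 - 1 = n - 3 by ring, show n - 2 + 1 = n - 1 by ring,
    show n - 2 + 2 = n by ring, show n - 2 + 3 = n + 1 by ring, show n - 2 + 4 = n + 2 by ring,
    show n - 2 + 5 = n + 3 by ring]
  omega

def Encl (t : ℕ) (s : ℤ → Fin 2) (u : ℤ → ℝ) : Prop := ∀ n, In (ent t (wd s n)) (u n)

theorem fin2_cases (x : Fin 2) : x.val = 0 ∨ x.val = 1 := by omega

theorem Encl.nb1 {t : ℕ} {s : ℤ → Fin 2} {u : ℤ → ℝ} (h : Encl t s u) (n : ℤ) :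
    In (nb1 t (wd s n)) (u (n + 1)) := by
  have := h (n + 1)
  rw [wd_succ] at this
  rcases fin2_cases (s (n + 6)) with h1 | h1 <;> rw [h1] at this
  · exact this.hull_left
  · exact this.hull_right

theorem Encl.pb1 {t : ℕ} {s : ℤ → Fin 2} {u : ℤ → ℝ} (h : Encl t s u) (n : ℤ) :
    In (pb1 t (wd s n)) (u (n - 1)) := by
  have := h (n - 1)
  rw [wd_pred] at this
  rcases fin2_cases (s (n - 3)) with h1 | h1 <;> rw [h1] at this
  · exact this.hull_left
  · exact this.hull_right

theorem Encl.nb2 {t : ℕ} {s : ℤ → Fin 2} {u : ℤ → ℝ} (h : Encl t s u) (n : ℤ) :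
    In (nb2 t (wd s n)) (u (n + 2)) := by
  have := h (n + 2)
  rw [wd_succ2] at this
  rcases fin2_cases (s (n + 6)) with h1 | h1 <;> rcases fin2_cases (s (n + 7)) with h2 | h2 <;>
    rw [h1, h2] at this
  · exact In.hull_left this.hull_left
  · exact In.hull_left this.hull_right
  · exact In.hull_right this.hull_left
  · exact In.hull_right this.hull_right

theorem Encl.pb2 {t : ℕ} {s : ℤ → Fin 2} {u : ℤ → ℝ} (h : Encl t s u) (n : ℤ) :
    In (pb2 t (wd s n)) (u (n - 2)) := by
  have := h (n - 2)
  rw [wd_pred2] at this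
  rcases fin2_cases (s (n - 3)) with h1 | h1 <;> rcases fin2_cases (s (n - 4)) with h2 | h2 <;>
    rw [h1, h2] at this
  · exact In.hull_left this.hull_left
  · exact In.hull_right this.hull_left
  · exact In.hull_left this.hull_right
  · exact In.hull_right this.hull_right

theorem fpl_spec {alo ahi t : ℕ} {a b : ℝ} (hp : Par alo ahi a b) {s : ℤ → Fin 2} {u : ℤ → ℝ}
    (hE : Encl t s u) (hR : ∀ n, |u n| ≤ 39321) (n : ℤ) :
    (fpl alo ahi t (wd s n) = none ∧ pz a b (u (n + 1)) (u (n - 1)) < 0) ∨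
    ∃ gl gh : ℕ, fpl alo ahi t (wd s n) = some (false, gl, gh) ∧
      (gl : ℝ) ≤ √(pz a b (u (n + 1)) (u (n - 1))) ∧ √(pz a b (u (n + 1)) (u (n - 1))) ≤ gh := by
  obtain ⟨nl, nh, e1, h1, h2⟩ := hE.nb1 n
  obtain ⟨pl, ph, e2, h3, h4⟩ := hE.pb1 n
  have hf : fpl alo ahi t (wd s n) = plain alo ahi nl nh pl ph := by
    unfold fpl; rw [e1, e2]
  rw [hf]
  rcases hc : plain alo ahi nl nh pl ph with _ | ⟨c, gl, gh⟩
  · left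
    exact ⟨rfl, plain_none hp h1 h3 (hR _) hc⟩
  · right
    obtain ⟨rfl, h5, h6⟩ := plain_some hp h1 h3 h2 h4 (hR _) hc
    exact ⟨gl, gh, rfl, h5, h6⟩

theorem core_spec {alo ahi t : ℕ} {a b : ℝ} (hp : Par alo ahi a b) {s : ℤ → Fin 2} {u : ℤ → ℝ}
    (hE : Encl t s u) (hR : ∀ n, |u n| ≤ 39321) (n : ℤ) {xl xh : ℕ}
    (hx : xl ≤ u n + 65536) (hx' : u n + 65536 ≤ xh) :
    (core alo ahi t (wd s n) xl xh = none ∧ (pz a b (u (n + 1)) (u (n - 1)) < 0 ∨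
      crit (wd s n) = true ∧ cG a b (u n) (u (n + 2)) (u (n - 2)) < 0)) ∨
    (∃ gl gh : ℕ, core alo ahi t (wd s n) xl xh = some (false, gl, gh) ∧
      (gl : ℝ) ≤ √(pz a b (u (n + 1)) (u (n - 1))) ∧ √(pz a b (u (n + 1)) (u (n - 1))) ≤ gh) ∨
    (∃ gl gh : ℕ, core alo ahi t (wd s n) xl xh = some (true, gl, gh) ∧ crit (wd s n) = true ∧
      (gl : ℝ) ≤ √(cG a b (u n) (u (n + 2)) (u (n - 2))) ∧
      √(cG a b (u n) (u (n + 2)) (u (n - 2))) ≤ gh) := by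
  have hF := fpl_spec hp hE hR n
  have key : core alo ahi t (wd s n) xl xh = fpl alo ahi t (wd s n) →
    (core alo ahi t (wd s n) xl xh = none ∧ (pz a b (u (n + 1)) (u (n - 1)) < 0 ∨
      crit (wd s n) = true ∧ cG a b (u n) (u (n + 2)) (u (n - 2)) < 0)) ∨
    (∃ gl gh : ℕ, core alo ahi t (wd s n) xl xh = some (false, gl, gh) ∧
      (gl : ℝ) ≤ √(pz a b (u (n + 1)) (u (n - 1))) ∧ √(pz a b (u (n + 1)) (u (n - 1))) ≤ gh) := by
    intro hh
    rw [hh]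
    rcases hF with ⟨h1, h2⟩ | h
    · left; exact ⟨h1, Or.inl h2⟩
    · right; exact h
  rcases hc : crit (wd s n) with _ | _
  · have := key (by unfold core; exact cond_f hc _ _)
    rw [hc] at this
    rcases this with h | h
    · left; exact h
    · right; left; exact h
  · rw [hc] at key
    obtain ⟨nl, nh, e1, h1, h2⟩ := hE.nb2 n
    obtain ⟨pl, ph, e2, h3, h4⟩ := hE.pb2 n
    have hf : core alo ahi t (wd s n) xl xh =
        critE alo ahi xl xh nl nh pl ph (fpl alo ahi t (wd s n)) := by
      unfold core; rw [cond_t hc, e1, e2]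
    rcases critE_spec hp hx hx' h1 h3 h2 h4 (hR _) (hR _) (fpl alo ahi t (wd s n)) with h | h | h
    · rcases key (hf.trans h) with h | h
      · left; exact h
      · right; left; exact h
    · left
      exact ⟨hf.trans h.1, Or.inr ⟨rfl, h.2⟩⟩
    · right; right
      obtain ⟨gl, gh, h5, h6, h7⟩ := h
      exact ⟨gl, gh, hf.trans h5, rfl, h6, h7⟩
theorem pack_aux (f p : ℕ → ℕ) (B : ℕ) (hB : 0 < B)
    (hp : ∀ m, p (m + 1) = f (255 - m) % B + B * p m) (n : ℕ) (hn : n ≤ 256) (w : ℕ) (hw : w < n) :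
    p n / B ^ w % B = f (256 - n + w) % B := by
  induction n generalizing w with
  | zero => omega
  | succ n ih =>
    rw [hp]
    cases w with
    | zero =>
      rw [pow_zero, Nat.div_one, Nat.add_mul_mod_self_left, Nat.mod_mod]
      congr 2
      omega
    | succ w =>
      rw [pow_succ', ← Nat.div_div_eq_div_mul, Nat.add_mul_div_left _ _ hB,
        Nat.div_eq_of_lt (Nat.mod_lt _ hB), zero_add, ih (by omega) w (by omega)]
      congr 2
      omega

theorem pack_get (f : ℕ → ℕ) (w : ℕ) (hw : w < 256) :
    pack f 256 / 68719476736 ^ w % 68719476736 = f w % 68719476736 := by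
  have := pack_aux f (pack f) 68719476736 (by norm_num) (fun m => rfl) 256 le_rfl w hw
  rw [this, Nat.sub_self, zero_add]

theorem ent_some {t w e l h : ℕ} (he : t / 68719476736 ^ w % 68719476736 = e % 68719476736)
    (hl : l ≤ h) (h0 : 0 < h) (hh : h < 262144) (hE : e = l * 262144 + h) :
    ent t w = some (l, h) := by
  unfold ent
  simp only [force_eq]
  rw [he]
  have h1 : e % 68719476736 = e := Nat.mod_eq_of_lt (by omega)
  rw [h1]
  have h2 : Nat.beq e 0 = false := by
    rcases hb : Nat.beq e 0 with _ | _
    · rfl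
    · have := Nat.eq_of_beq_eq_true hb
      omega
  rw [cond_f h2]
  have h3 : e / 262144 = l := by omega
  have h4 : e % 262144 = h := by omega
  rw [h3, h4]

theorem ent_lt {t w l h : ℕ} (he : ent t w = some (l, h)) : h < 262144 := by
  unfold ent at he
  simp only [force_eq] at he
  generalize t / 68719476736 ^ w % 68719476736 = e at he
  rcases hb : Nat.beq e 0 with _ | _
  · rw [cond_f hb] at he
    simp only [Option.some.injEq, Prod.mk.injEq] at he
    rw [← he.2]
    exact Nat.mod_lt _ (by norm_num)
  · rw [cond_t hb] at he
    simp at he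

/-- bounded orbit with its code -/
structure Orb (a b : ℝ) (s : ℤ → Fin 2) (u : ℤ → ℝ) : Prop where
  bd : ∀ n, |u n| ≤ 39321
  eq : ∀ n, u n ^ 2 = 16384 * (16384 * a - u (n + 1) - b * u (n - 1))
  pos : ∀ n, s n = 1 → 0 ≤ u n
  neg : ∀ n, s n = 0 → u n ≤ 0

theorem Orb.pz {a b : ℝ} {s : ℤ → Fin 2} {u : ℤ → ℝ} (h : Orb a b s u) (n : ℤ) :
    pz a b (u (n + 1)) (u (n - 1)) = (2 * u n) ^ 2 := by
  unfold HP.pz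
  have := h.eq n
  linarith

theorem Orb.sqrt_pz {a b : ℝ} {s : ℤ → Fin 2} {u : ℤ → ℝ} (h : Orb a b s u) (n : ℤ) :
    2 * u n = bif tb (wd s n) 5 then √(HP.pz a b (u (n + 1)) (u (n - 1))) else
      -√(HP.pz a b (u (n + 1)) (u (n - 1))) := by
  rw [h.pz, Real.sqrt_sq_eq_abs]
  rcases hb : tb (wd s n) 5 with _ | _
  · rw [cond_f rfl, abs_of_nonpos]
    · ring
    · linarith [h.neg n ((tb5_f s n).1 hb)]
  · rw [cond_t rfl, abs_of_nonneg]
    linarith [h.pos n ((tb5_t s n).1 hb)]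

theorem Orb.cG {a b : ℝ} {s : ℤ → Fin 2} {u : ℤ → ℝ} (h : Orb a b s u) (n : ℤ)
    (hc : crit (wd s n) = true) :
    (2 * u n - 2560) ^ 2 = cG a b (u n) (u (n + 2)) (u (n - 2)) := by
  obtain ⟨h1, h2, -⟩ := (crit_iff s n).1 hc
  have e1 := h.pz (n + 1)
  have e2 := h.pz (n - 1)
  rw [show n + 1 + 1 = n + 2 by ring, show n + 1 - 1 = n by ring] at e1
  rw [show n - 1 + 1 = n by ring, show n - 1 - 1 = n - 2 by ring] at e2
  unfold HP.cG
  rw [e1, e2, Real.sqrt_sq (by linarith [h.pos _ h2]), Real.sqrt_sq (by linarith [h.pos _ h1])]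
  have := h.eq n
  linarith

theorem step_sound {alo ahi t : ℕ} {a b : ℝ} (hp : Par alo ahi a b) {s : ℤ → Fin 2} {u : ℤ → ℝ}
    (ho : Orb a b s u) (hE : Encl t s u) :
    Encl (pack (fun w => newent alo ahi t w) 256) s u := by
  intro n
  obtain ⟨xl, xh, e1, h1, h2⟩ := hE n
  have hu0 : 0 ≤ u n + 65536 := by linarith [(abs_le.1 (ho.bd n)).1]
  have main : ∃ c gl gh, core alo ahi t (wd s n) xl xh = some (c, gl, gh) ∧
      (outl (tb (wd s n) 5) c gl gh : ℝ) ≤ u n + 65536 ∧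
      u n + 65536 ≤ outh (tb (wd s n) 5) c gl gh := by
    rcases core_spec hp hE ho.bd n h1 h2 with ⟨-, h | ⟨hc, h⟩⟩ | ⟨gl, gh, hc, h3, h4⟩ |
      ⟨gl, gh, hc, hc', h3, h4⟩
    · rw [ho.pz] at h
      exact absurd h (not_lt.2 (sq_nonneg _))
    · rw [← ho.cG n hc] at h
      exact absurd h (not_lt.2 (sq_nonneg _))
    · exact ⟨_, gl, gh, hc, out_plain h3 h4 (ho.sqrt_pz n) (Or.inl hu0)⟩
    · exact ⟨_, gl, gh, hc, out_crit' h3 h4 (ho.cG n hc')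
        (fun h => ho.pos n ((tb5_t s n).1 h)) (fun h => ho.neg n ((tb5_f s n).1 h)) hu0⟩
  obtain ⟨c, gl, gh, hc, h3, h4⟩ := main
  have hl : ((max (outl (tb (wd s n) 5) c gl gh) xl : ℕ) : ℝ) ≤ u n + 65536 := by
    push_cast; exact max_le h3 h1
  have hh : u n + 65536 ≤ ((min (outh (tb (wd s n) 5) c gl gh) xh : ℕ) : ℝ) := by
    push_cast; exact le_min h4 h2
  have hxh := ent_lt e1
  have hm : min (outh (tb (wd s n) 5) c gl gh) xh ≤ xh := min_le_right _ _
  have hne : newent alo ahi t (wd s n) =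
      bif Nat.ble (max (outl (tb (wd s n) 5) c gl gh) xl) (min (outh (tb (wd s n) 5) c gl gh) xh) then
      (max (outl (tb (wd s n) 5) c gl gh) xl) * 262144 + (min (outh (tb (wd s n) 5) c gl gh) xh)
      else 0 := by
    unfold newent
    rw [e1]
    simp only []
    rw [hc]
    simp only [force_eq]
  generalize max (outl (tb (wd s n) 5) c gl gh) xl = l at *
  generalize min (outh (tb (wd s n) 5) c gl gh) xh = h at *
  have hlh : l ≤ h := by exact_mod_cast hl.trans hh
  rw [cond_t (Nat.ble_eq_true_of_le hlh)] at hne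
  have hpos : 0 < h := by
    have : (0 : ℝ) < h := by linarith [(abs_le.1 (ho.bd n)).1]
    exact_mod_cast this
  exact ⟨l, h, ent_some (pack_get _ _ (wd_lt s n)) hlh hpos (by omega) hne, hl, hh⟩

theorem ini_sound {a b : ℝ} {s : ℤ → Fin 2} {u : ℤ → ℝ} (ho : Orb a b s u) : Encl ini0 s u := by
  intro n
  have hb := abs_le.1 (ho.bd n)
  rcases h : tb (wd s n) 5 with _ | _
  · refine ⟨26215, 65536, ent_some (pack_get _ _ (wd_lt s n)) (by norm_num) (by norm_num)
      (by norm_num) (cond_f h _ _), ?_, ?_⟩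
    · push_cast; linarith
    · push_cast; linarith [ho.neg n ((tb5_f s n).1 h)]
  · refine ⟨65536, 104857, ent_some (pack_get _ _ (wd_lt s n)) (by norm_num) (by norm_num)
      (by norm_num) (cond_t h _ _), ?_, ?_⟩
    · push_cast; linarith [ho.pos n ((tb5_t s n).1 h)]
    · push_cast; linarith

theorem iter_sound {alo ahi : ℕ} {a b : ℝ} (hp : Par alo ahi a b) {s : ℤ → Fin 2} {u : ℤ → ℝ}
    (ho : Orb a b s u) (k : ℕ) : Encl (iter alo ahi k) s u := by
  induction k with
  | zero => exact ini_sound ho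
  | succ k ih =>
    have : iter alo ahi (k + 1) = force (iter alo ahi k) fun t =>
      pack (fun w => force w fun w => newent alo ahi t w) 256 := rfl
    rw [this]
    simp only [force_eq]
    exact step_sound hp ho ih
theorem lipP_real {a b N N' P P' g C w w1 w2 : ℝ} (hg : 0 < g) (hC : 0 ≤ C) (hw2 : 0 ≤ w2)
    (hb0 : 255 / 256 ≤ 4 * b) (hb1 : 4 * b ≤ 257 / 256)
    (h1 : g ≤ √(pz a b N P)) (h2 : g ≤ √(pz a b N' P'))
    (hN : |N - N'| ≤ C * w1) (hP : |P - P'| ≤ C * w2)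
    (hl : 16384 * (64 * w1 + 17 * w2) ≤ 56 * g * w) :
    |√(pz a b N P) - √(pz a b N' P')| / 2 ≤ 7 / 8 * (C * w) := by
  have h3 := sqrt_diff_abs hg h1 h2
  have e : pz a b N P - pz a b N' P' = -(65536 * (N - N') + 16384 * (4 * b) * (P - P')) := by
    unfold pz; ring
  have h4 : |pz a b N P - pz a b N' P'| ≤ 65536 * (C * w1) + 17408 * (C * w2) := by
    rw [e, abs_neg]
    refine (abs_add_le _ _).trans ?_
    rw [abs_mul, abs_mul, abs_of_nonneg (by linarith : (0:ℝ) ≤ 16384 * (4 * b)),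
      abs_of_nonneg (by norm_num : (0:ℝ) ≤ 65536)]
    have : 16384 * (4 * b) * |P - P'| ≤ 17408 * (C * w2) :=
      mul_le_mul (by linarith) hP (abs_nonneg _) (by norm_num)
    linarith
  have h5 : 16384 * (64 * (C * w1) + 17 * (C * w2)) ≤ 56 * g * (C * w) := by
    have := mul_le_mul_of_nonneg_left hl hC
    linarith
  have h6 : |pz a b N P - pz a b N' P'| / (2 * g) ≤ 7 / 4 * (C * w) := by
    rw [div_le_iff₀ (by positivity)]
    linarith
  linarith

theorem lipX_hi {A B v w m q c : ℝ} (hc : 0 ≤ c) (hm : 0 < m) (hq : 268435456 / m ≤ q) (hvw : v ≤ w)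
    (h : m ≤ √(16384 * (A - B - c * w))) :
    32768 * (√(16384 * (A - B - c * v)) - √(16384 * (A - B - c * w))) ≤ c * q * (w - v) := by
  have h1 := sqrt_diff (p := 16384 * (A - B - c * v)) hm h (by nlinarith)
  have h2 : 268435456 / m * (c * (w - v)) ≤ q * (c * (w - v)) :=
    mul_le_mul_of_nonneg_right hq (mul_nonneg hc (by linarith))
  have h3 : 32768 * ((16384 * (A - B - c * v) - 16384 * (A - B - c * w)) / (2 * m)) =
    268435456 / m * (c * (w - v)) := by field_simp; ring
  linarith

theorem lipX_lo {A B v w m q c : ℝ} (hc : 0 ≤ c) (hm : 0 < m) (hq : q ≤ 268435456 / m) (hvw : v ≤ w)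
    (h : √(16384 * (A - B - c * v)) ≤ m) (h0 : 0 < √(16384 * (A - B - c * w))) :
    c * q * (w - v) ≤ 32768 * (√(16384 * (A - B - c * v)) - √(16384 * (A - B - c * w))) := by
  have h1 := sqrt_diff' hm h (Real.sqrt_pos.1 h0).le (by nlinarith)
  have h2 : q * (c * (w - v)) ≤ 268435456 / m * (c * (w - v)) :=
    mul_le_mul_of_nonneg_right hq (mul_nonneg hc (by linarith))
  have h3 : 32768 * ((16384 * (A - B - c * v) - 16384 * (A - B - c * w)) / (2 * m)) =
    268435456 / m * (c * (w - v)) := by field_simp; ring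
  linarith

theorem pz_form1 (a b N u : ℝ) : pz a b N u = 16384 * (65536 * a - 4 * N - 4 * b * u) := by
  unfold pz; ring
theorem pz_form2 (a b u P : ℝ) : pz a b u P = 16384 * (65536 * a - 4 * b * P - 4 * u) := by
  unfold pz; ring

theorem lipG_u {a b N P u v X0 Y0 X1 Y1 q1 q2 q3 q4 D : ℝ} (hX0 : 0 < X0) (hY0 : 0 < Y0)
    (hX1 : 0 < X1) (hY1 : 0 < Y1)
    (hb0 : 255 / 256 ≤ 4 * b) (hb1 : 4 * b ≤ 257 / 256)
    (hq1 : 268435456 / X0 ≤ q1) (hq2 : 268435456 / Y0 ≤ q2)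
    (hq3 : q3 ≤ 268435456 / X1) (hq4 : q4 ≤ 268435456 / Y1) (hq30 : 0 ≤ q3) (hq40 : 0 ≤ q4)
    (xu : X0 ≤ √(pz a b N u)) (xv : √(pz a b N v) ≤ X1)
    (yu : Y0 ≤ √(pz a b u P)) (yv : √(pz a b v P) ≤ Y1)
    (hD1 : 257 / 256 * (q1 + q2) - 10240 ≤ D) (hD2 : 10240 - 255 / 256 * (q3 + q4) ≤ D)
    (hvu : v ≤ u) :
    |cG a b u N P - cG a b v N P| ≤ D * (u - v) := by
  have hb : 0 ≤ 4 * b := by linarith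
  have hd : 0 ≤ u - v := by linarith
  have hq10 : 0 ≤ q1 := le_trans (by positivity) hq1
  have hq20 : 0 ≤ q2 := le_trans (by positivity) hq2
  unfold cG
  rw [pz_form1] at xu xv
  rw [pz_form2] at yu yv
  rw [pz_form1 a b N u, pz_form1 a b N v, pz_form2 a b u, pz_form2 a b v]
  have h1 := lipX_hi hb hX0 hq1 hvu xu
  have h2 := lipX_lo hb hX1 hq3 hvu xv (lt_of_lt_of_le hX0 xu)
  have h3 := lipX_hi (by norm_num : (0:ℝ) ≤ 4) hY0 hq2 hvu yu
  have h4 := lipX_lo (by norm_num : (0:ℝ) ≤ 4) hY1 hq4 hvu yv (lt_of_lt_of_le hY0 yu)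
  generalize √(16384 * (65536 * a - 4 * N - 4 * b * u)) = x at *
  generalize √(16384 * (65536 * a - 4 * N - 4 * b * v)) = x' at *
  generalize √(16384 * (65536 * a - 4 * b * P - 4 * u)) = y at *
  generalize √(16384 * (65536 * a - 4 * b * P - 4 * v)) = y' at *
  have hb' : 0 ≤ b := by linarith
  have h3' := mul_le_mul_of_nonneg_left h3 hb'
  have h4' := mul_le_mul_of_nonneg_left h4 hb'
  have m1 : 4 * b * (q1 + q2) * (u - v) ≤ 257 / 256 * (q1 + q2) * (u - v) :=
    mul_le_mul_of_nonneg_right (mul_le_mul_of_nonneg_right hb1 (by linarith)) hd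
  have m2 : 255 / 256 * (q3 + q4) * (u - v) ≤ 4 * b * (q3 + q4) * (u - v) :=
    mul_le_mul_of_nonneg_right (mul_le_mul_of_nonneg_right hb0 (by linarith)) hd
  have m3 := mul_le_mul_of_nonneg_right hD1 hd
  have m4 := mul_le_mul_of_nonneg_right hD2 hd
  rw [abs_le]
  constructor <;> linarith

theorem lipG_NP {a b N P N' P' v X0 Y0 q1 q2 : ℝ} (hX0 : 0 < X0) (hY0 : 0 < Y0)
    (hb0 : 255 / 256 ≤ 4 * b) (hb1 : 4 * b ≤ 257 / 256)
    (hq1 : 268435456 / X0 ≤ q1) (hq2 : 268435456 / Y0 ≤ q2)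
    (x1 : X0 ≤ √(pz a b N v)) (x2 : X0 ≤ √(pz a b N' v))
    (y1 : Y0 ≤ √(pz a b v P)) (y2 : Y0 ≤ √(pz a b v P')) :
    |cG a b v N P - cG a b v N' P'| ≤ 4 * q1 * |N - N'| + 17 / 64 * q2 * |P - P'| := by
  have h1 := sqrt_diff_abs hX0 x1 x2
  have h2 := sqrt_diff_abs hY0 y1 y2
  have e1 : pz a b N v - pz a b N' v = (-65536) * (N - N') := by unfold pz; ring
  have e2 : pz a b v P - pz a b v P' = (-65536 * b) * (P - P') := by unfold pz; ring
  have hb' : 0 ≤ b := by linarith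
  have hq20 : 0 ≤ q2 := le_trans (by positivity) hq2
  rw [e1, abs_mul, show |(-65536 : ℝ)| = 65536 by norm_num] at h1
  rw [e2, abs_mul, abs_mul, show |(-65536 : ℝ)| = 65536 by norm_num, abs_of_nonneg hb'] at h2
  have h3 : 65536 * |N - N'| / (2 * X0) * 32768 = 4 * (268435456 / X0) * |N - N'| := by
    field_simp; ring
  have h4 : 65536 * b * |P - P'| / (2 * Y0) * (32768 * b) =
      4 * b ^ 2 * (268435456 / Y0) * |P - P'| := by
    field_simp; ring
  have h5 : 4 * (268435456 / X0) * |N - N'| ≤ 4 * q1 * |N - N'| := by gcongr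
  have h6 : 4 * b ^ 2 * (268435456 / Y0) * |P - P'| ≤ 17 / 64 * q2 * |P - P'| := by
    gcongr
    nlinarith
  have e3 : cG a b v N P - cG a b v N' P' = -((√(pz a b N v) - √(pz a b N' v)) * 32768 +
      (√(pz a b v P) - √(pz a b v P')) * (32768 * b)) := by unfold cG; ring
  rw [e3, abs_neg]
  refine (abs_add_le _ _).trans ?_
  rw [abs_mul, abs_mul, abs_of_nonneg (by norm_num : (0:ℝ) ≤ 32768),
    abs_of_nonneg (by linarith : (0:ℝ) ≤ 32768 * b)]
  have h7 := mul_le_mul_of_nonneg_right h1 (by norm_num : (0:ℝ) ≤ 32768)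
  have h8 := mul_le_mul_of_nonneg_right h2 (by linarith : (0:ℝ) ≤ 32768 * b)
  linarith

theorem lipC_real {alo ahi : ℕ} {a b u v N N' P P' : ℝ} (hp : Par alo ahi a b)
    {xl xh nl nh pl ph g w : ℕ}
    (hx : xl ≤ u + 65536) (hx' : u + 65536 ≤ xh) (kx : xl ≤ v + 65536) (kx' : v + 65536 ≤ xh)
    (hN : nl ≤ N + 65536) (hN' : N + 65536 ≤ nh) (kN : nl ≤ N' + 65536) (kN' : N' + 65536 ≤ nh)
    (hP : pl ≤ P + 65536) (hP' : P + 65536 ≤ ph) (kP : pl ≤ P' + 65536) (kP' : P' + 65536 ≤ ph)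
    (huR : |u| ≤ 39321) (hPR : |P| ≤ 39321) (hvR : |v| ≤ 39321) (kPR : |P'| ≤ 39321)
    (hg0 : 0 < g) (hg : (g : ℝ) ≤ √(cG a b u N P)) (hg' : (g : ℝ) ≤ √(cG a b v N' P'))
    (hl : lipC alo ahi xl xh nl nh pl ph g w = true) {C : ℝ} (hC : 0 ≤ C) {w2 : ℕ}
    (hw2 : w2 = W5 (w / 16) ∨ w2 = W5 (w / 16 + 16))
    (du : |u - v| ≤ C * WT w) (dN : |N - N'| ≤ C * W5 (w % 32)) (dP : |P - P'| ≤ C * w2) :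
    |√(cG a b u N P) - √(cG a b v N' P')| / 2 ≤ 7 / 8 * (C * WT w) := by
  unfold lipC at hl
  simp only [force_eq] at hl
  rcases hX : Nat.beq (zd alo nh xh) 0 with _ | _
  swap
  · rw [cond_t hX] at hl; exact absurd hl Bool.false_ne_true
  rw [cond_f hX] at hl
  rcases hY : Nat.beq (zd alo xh ph) 0 with _ | _
  swap
  · rw [cond_t hY] at hl; exact absurd hl Bool.false_ne_true
  rw [cond_f hY] at hl
  rcases hX' : Nat.beq (zu ahi nl xl) 0 with _ | _
  swap
  · rw [cond_t hX'] at hl; exact absurd hl Bool.false_ne_true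
  rw [cond_f hX'] at hl
  rcases hY' : Nat.beq (zu ahi xl pl) 0 with _ | _
  swap
  · rw [cond_t hY'] at hl; exact absurd hl Bool.false_ne_true
  rw [cond_f hY'] at hl
  have hX0 : zd alo nh xh ≠ 0 := fun h => by simp [h] at hX
  have hY0 : zd alo xh ph ≠ 0 := fun h => by simp [h] at hY
  have hX1 : zu ahi nl xl ≠ 0 := fun h => by simp [h] at hX'
  have hY1 : zu ahi xl pl ≠ 0 := fun h => by simp [h] at hY'
  have hX0' : (0 : ℝ) < zd alo nh xh := by exact_mod_cast Nat.pos_of_ne_zero hX0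
  have hY0' : (0 : ℝ) < zd alo xh ph := by exact_mod_cast Nat.pos_of_ne_zero hY0
  have hX1' : (0 : ℝ) < zu ahi nl xl := by exact_mod_cast Nat.pos_of_ne_zero hX1
  have hY1' : (0 : ℝ) < zu ahi xl pl := by exact_mod_cast Nat.pos_of_ne_zero hY1
  have q1 := div_q _ hX0
  have q2 := div_q _ hY0
  have q3 := div_q' (zu ahi nl xl)
  have q4 := div_q' (zu ahi xl pl)
  generalize (268435456 / zd alo nh xh + 1) = Q1 at *
  generalize (268435456 / zd alo xh ph + 1) = Q2 at *
  generalize (268435456 / zu ahi nl xl) = Q3 at *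
  generalize (268435456 / zu ahi xl pl) = Q4 at *
  have hd1 := sub_le' (257 * (Q1 + Q2)) 2621440
  have hd2 := sub_le' 2621440 (255 * (Q3 + Q4))
  generalize (257 * (Q1 + Q2) - 2621440) = d1 at *
  generalize (2621440 - 255 * (Q3 + Q4)) = d2 at *
  have hD : d1 + d2 ≤ 256 * ((d1 + d2) / 256 + 1) := by omega
  generalize (d1 + d2) / 256 + 1 = D at *
  have hD' : (d1 : ℝ) + d2 ≤ 256 * D := by exact_mod_cast hD
  have hd10 : (0 : ℝ) ≤ d1 := Nat.cast_nonneg _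
  have hd20 : (0 : ℝ) ≤ d2 := Nat.cast_nonneg _
  push_cast at hd1 hd2
  rw [Bool.and_eq_true] at hl
  have hl' : 64 * (D * WT w + 4 * Q1 * W5 (w % 32)) + 17 * Q2 * w2 ≤ 224 * g * WT w := by
    rcases hw2 with rfl | rfl
    · exact Nat.le_of_ble_eq_true hl.1
    · exact Nat.le_of_ble_eq_true hl.2
  have hl2 : 64 * ((D : ℝ) * WT w + 4 * Q1 * W5 (w % 32)) + 17 * Q2 * w2 ≤ 224 * g * WT w := by
    exact_mod_cast hl'
  have gA : |cG a b u N P - cG a b v N P| ≤ D * |u - v| := by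
    rcases le_total v u with h | h
    · rw [abs_of_nonneg (by linarith : 0 ≤ u - v)]
      exact lipG_u hX0' hY0' hX1' hY1' hp.blo hp.bhi q1 q2 q3 q4 (Nat.cast_nonneg _)
        (Nat.cast_nonneg _) (pz_lo hp hN' hx' huR) (pz_hi hp hN kx hvR) (pz_lo hp hx' hP' hPR)
        (pz_hi hp kx hP hPR) (by linarith) (by linarith) h
    · rw [abs_sub_comm, abs_sub_comm u, abs_of_nonneg (by linarith : 0 ≤ v - u)]
      exact lipG_u hX0' hY0' hX1' hY1' hp.blo hp.bhi q1 q2 q3 q4 (Nat.cast_nonneg _)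
        (Nat.cast_nonneg _) (pz_lo hp hN' kx' hvR) (pz_hi hp hN hx huR) (pz_lo hp kx' hP' hPR)
        (pz_hi hp hx hP hPR) (by linarith) (by linarith) h
  have gB := lipG_NP (N := N) (P := P) (N' := N') (P' := P') (v := v) hX0' hY0' hp.blo hp.bhi q1 q2
    (pz_lo hp hN' kx' hvR) (pz_lo hp kN' kx' hvR) (pz_lo hp kx' hP' hPR) (pz_lo hp kx' kP' kPR)
  have gC := abs_sub_le (cG a b u N P) (cG a b v N P) (cG a b v N' P')
  have hg0' : (0 : ℝ) < g := by exact_mod_cast hg0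
  have hS := sqrt_diff_abs hg0' hg hg'
  have i1 := mul_le_mul_of_nonneg_left du (Nat.cast_nonneg D : (0 : ℝ) ≤ D)
  have i2 := mul_le_mul_of_nonneg_left dN (by positivity : (0 : ℝ) ≤ 4 * Q1)
  have i3 := mul_le_mul_of_nonneg_left dP (by positivity : (0 : ℝ) ≤ 17 / 64 * Q2)
  have i4 := mul_le_mul_of_nonneg_left hl2 hC
  have h6 : |cG a b u N P - cG a b v N' P'| / (2 * g) ≤ 7 / 4 * (C * WT w) := by
    rw [div_le_iff₀ (by positivity)]
    linarith
  linarith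
theorem okall_get {alo ahi t n : ℕ} (h : okall alo ahi t n = true) (w : ℕ) (hw : w < n) :
    okw alo ahi t w = true := by
  induction n with
  | zero => omega
  | succ n ih =>
    have e : okall alo ahi t (n + 1) = (okw alo ahi t n && okall alo ahi t n) := rfl
    rw [e, Bool.and_eq_true] at h
    rcases Nat.lt_succ_iff_lt_or_eq.1 hw with h1 | rfl
    · exact ih h.2 h1
    · exact h.1

def Good (alo ahi t : ℕ) : Prop := ∀ w < 256, okw alo ahi t w = true

theorem good_of_check {alo ahi : ℕ} (h : check alo ahi = true) : Good alo ahi (iter alo ahi 11) := by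
  unfold check at h
  rw [force_eq] at h
  exact fun w hw => okall_get h w hw

theorem Good.forb {alo ahi t : ℕ} (h : Good alo ahi t) {w : ℕ} (hw : w < 256) {p : ℕ × ℕ}
    (hf : ent t w = some p) : forb w = false := by
  have h1 := h w hw
  unfold okw at h1
  rcases hb : HP.forb w with _ | _
  · rfl
  · rw [cond_t hb, hf] at h1
    simp at h1

structure Dat (alo ahi t w xl xh : ℕ) (c : Bool) (gl gh : ℕ) : Prop where
  hent : ent t w = some (xl, xh)
  hcore : core alo ahi t w xl xh = some (c, gl, gh)
  hc : c = crit w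
  hx : xl ≤ xh
  hxl : 26215 ≤ xl
  hxh : xh ≤ 104857
  hl : xl ≤ outl (tb w 5) c gl gh
  hh : outh (tb w 5) c gl gh ≤ xh
  hg : 1 ≤ gl
  hsp : tb w 5 = true → 65537 ≤ xl
  hsn : tb w 5 = false → xh ≤ 65535
  hcg : c = true → tb w 5 = true → 2561 ≤ gl
  hW : 1 ≤ WT w
  hlip : lip alo ahi t w xl xh gl c = true

theorem Good.dat {alo ahi t : ℕ} (h : Good alo ahi t) {w : ℕ} (hw : w < 256)
    (hf : HP.forb w = false) : ∃ xl xh c gl gh, Dat alo ahi t w xl xh c gl gh := by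
  have h1 := h w hw
  unfold okw at h1
  rw [cond_f hf] at h1
  rcases he : ent t w with _ | ⟨xl, xh⟩
  · rw [he] at h1; exact absurd h1 Bool.false_ne_true
  rw [he] at h1
  simp only [] at h1
  rcases hc : core alo ahi t w xl xh with _ | ⟨c, gl, gh⟩
  · rw [hc] at h1; exact absurd h1 Bool.false_ne_true
  rw [hc] at h1
  simp only [] at h1
  rw [Bool.and_eq_true, Bool.and_eq_true, Bool.and_eq_true, Bool.and_eq_true, Bool.and_eq_true,
    Bool.and_eq_true, Bool.and_eq_true, Bool.and_eq_true, Bool.and_eq_true, Bool.and_eq_true] at h1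
  obtain ⟨a1, a2, a3, a4, a5, a6, a7, a8, a9, a10, a11⟩ := h1
  refine ⟨xl, xh, c, gl, gh, he, hc, eq_of_beq a1, Nat.le_of_ble_eq_true a2,
    Nat.le_of_ble_eq_true a3, Nat.le_of_ble_eq_true a4, Nat.le_of_ble_eq_true a5,
    Nat.le_of_ble_eq_true a6, Nat.le_of_ble_eq_true a7, ?_, ?_, ?_, Nat.le_of_ble_eq_true a10, a11⟩
  · intro ht
    rw [cond_t ht] at a8
    exact Nat.le_of_ble_eq_true a8
  · intro ht
    rw [cond_f ht] at a8
    exact Nat.le_of_ble_eq_true a8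
  · intro ht ht'
    rw [ht, ht', cond_t (by rfl)] at a9
    exact Nat.le_of_ble_eq_true a9

/-- the operator -/
noncomputable def Tm (a b : ℝ) (s : ℤ → Fin 2) (u : ℤ → ℝ) (n : ℤ) : ℝ :=
  bif crit (wd s n) then
    (2560 + bif tb (wd s n) 5 then √(cG a b (u n) (u (n + 2)) (u (n - 2)))
      else -√(cG a b (u n) (u (n + 2)) (u (n - 2)))) / 2
  else
    (bif tb (wd s n) 5 then √(pz a b (u (n + 1)) (u (n - 1)))
      else -√(pz a b (u (n + 1)) (u (n - 1)))) / 2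

def NF (s : ℤ → Fin 2) : Prop := ∀ n, forb (wd s n) = false

theorem Encl.nf {alo ahi t : ℕ} (h : Good alo ahi t) {s : ℤ → Fin 2} {u : ℤ → ℝ}
    (hE : Encl t s u) : NF s := by
  intro n
  obtain ⟨l, h', e, -⟩ := hE n
  exact h.forb (wd_lt s n) e

theorem In.of_some {t w l h : ℕ} {u : ℝ} (hi : In (ent t w) u) (he : ent t w = some (l, h)) :
    (l : ℝ) ≤ u + 65536 ∧ u + 65536 ≤ h := by
  obtain ⟨l', h', e, h1, h2⟩ := hi
  rw [he] at e
  simp only [Option.some.injEq, Prod.mk.injEq] at e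
  rw [e.1, e.2]
  exact ⟨h1, h2⟩

theorem Encl.bd {alo ahi t : ℕ} (h : Good alo ahi t) {s : ℤ → Fin 2} {u : ℤ → ℝ}
    (hE : Encl t s u) (n : ℤ) : |u n| ≤ 39321 := by
  obtain ⟨xl, xh, c, gl, gh, d⟩ := h.dat (wd_lt s n) (hE.nf h n)
  obtain ⟨h1, h2⟩ := (hE n).of_some d.hent
  have h3 : (26215 : ℝ) ≤ xl := by exact_mod_cast d.hxl
  have h4 : (xh : ℝ) ≤ 104857 := by exact_mod_cast d.hxh
  rw [abs_le]; constructor <;> linarith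

/-- the core facts for a good table -/
theorem Encl.core {alo ahi t : ℕ} {a b : ℝ} (hp : Par alo ahi a b) (h : Good alo ahi t)
    {s : ℤ → Fin 2} {u : ℤ → ℝ} (hE : Encl t s u) {n : ℤ} {xl xh gl gh : ℕ} {c : Bool}
    (d : Dat alo ahi t (wd s n) xl xh c gl gh) :
    (crit (wd s n) = false ∧ c = false ∧ (gl : ℝ) ≤ √(pz a b (u (n + 1)) (u (n - 1))) ∧
      √(pz a b (u (n + 1)) (u (n - 1))) ≤ gh) ∨
    (crit (wd s n) = true ∧ c = true ∧ (gl : ℝ) ≤ √(cG a b (u n) (u (n + 2)) (u (n - 2))) ∧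
      √(cG a b (u n) (u (n + 2)) (u (n - 2))) ≤ gh) := by
  obtain ⟨h1, h2⟩ := (hE n).of_some d.hent
  rcases core_spec hp hE (hE.bd h) n h1 h2 with ⟨h3, -⟩ | ⟨gl', gh', h3, h4, h5⟩ |
      ⟨gl', gh', h3, h6, h4, h5⟩
  · rw [d.hcore] at h3; exact absurd h3 (by simp)
  · rw [d.hcore] at h3
    simp only [Option.some.injEq, Prod.mk.injEq] at h3
    obtain ⟨rfl, rfl, rfl⟩ := h3
    left
    exact ⟨d.hc.symm, rfl, h4, h5⟩
  · rw [d.hcore] at h3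
    simp only [Option.some.injEq, Prod.mk.injEq] at h3
    obtain ⟨rfl, rfl, rfl⟩ := h3
    right
    exact ⟨h6, rfl, h4, h5⟩

theorem Tm_maps {alo ahi t : ℕ} {a b : ℝ} (hp : Par alo ahi a b) (h : Good alo ahi t)
    {s : ℤ → Fin 2} {u : ℤ → ℝ} (hE : Encl t s u) : Encl t s (Tm a b s u) := by
  intro n
  obtain ⟨xl, xh, c, gl, gh, d⟩ := h.dat (wd_lt s n) (hE.nf h n)
  refine ⟨xl, xh, d.hent, ?_⟩
  have h3 : (xl : ℝ) ≤ outl (tb (wd s n) 5) c gl gh := by exact_mod_cast d.hl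
  have h4 : (outh (tb (wd s n) 5) c gl gh : ℝ) ≤ xh := by exact_mod_cast d.hh
  have h5 : 0 < outl (tb (wd s n) 5) c gl gh := by have := d.hl; have := d.hxl; omega
  have key : (outl (tb (wd s n) 5) c gl gh : ℝ) ≤ Tm a b s u n + 65536 ∧
      Tm a b s u n + 65536 ≤ outh (tb (wd s n) 5) c gl gh := by
    rcases hE.core hp h d with ⟨hc, rfl, h1, h2⟩ | ⟨hc, rfl, h1, h2⟩
    · refine out_plain h1 h2 ?_ (Or.inr h5)
      unfold Tm; rw [cond_f hc]; ring
    · refine out_crit h1 h2 ?_ (Or.inr h5)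
      unfold Tm; rw [cond_t hc]; ring
  exact ⟨h3.trans key.1, key.2.trans h4⟩

theorem WT_succ (s : ℤ → Fin 2) (n : ℤ) : WT (wd s (n + 1)) = W5 (wd s n / 2 % 32) := by
  unfold WT
  rw [wd_succ]
  congr 1
  omega

theorem WT_pred (s : ℤ → Fin 2) (n : ℤ) : WT (wd s (n - 1)) = W5 (wd s n / 8 % 32) := by
  unfold WT
  rw [wd_pred]
  congr 1
  have := wd_lt s n
  omega

theorem WT_succ2 (s : ℤ → Fin 2) (n : ℤ) : WT (wd s (n + 2)) = W5 (wd s n % 32) := by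
  unfold WT
  rw [wd_succ2]
  congr 1
  omega

theorem WT_pred2 (s : ℤ → Fin 2) (n : ℤ) :
    WT (wd s (n - 2)) = W5 (wd s n / 16) ∨ WT (wd s (n - 2)) = W5 (wd s n / 16 + 16) := by
  unfold WT
  rw [wd_pred2]
  have := wd_lt s n
  rcases fin2_cases (s (n - 3)) with h1 | h1
  · left; congr 1; omega
  · right; congr 1; omega

theorem sgn_diff (e : Bool) (x y : ℝ) :
    |(bif e then x else -x) / 2 - (bif e then y else -y) / 2| = |x - y| / 2 := by
  cases e
  · rw [cond_false, cond_false, show -x / 2 - -y / 2 = -((x - y) / 2) by ring, abs_neg, abs_div,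
      abs_of_nonneg (by norm_num : (0:ℝ) ≤ 2)]
  · rw [cond_true, cond_true, ← sub_div, abs_div, abs_of_nonneg (by norm_num : (0:ℝ) ≤ 2)]

theorem Tm_lip {alo ahi t : ℕ} {a b : ℝ} (hp : Par alo ahi a b) (h : Good alo ahi t)
    {s : ℤ → Fin 2} {u v : ℤ → ℝ} (hE : Encl t s u) (hF : Encl t s v) {C : ℝ} (hC : 0 ≤ C)
    (hd : ∀ n, |u n - v n| ≤ C * WT (wd s n)) (n : ℤ) :
    |Tm a b s u n - Tm a b s v n| ≤ 7 / 8 * (C * WT (wd s n)) := by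
  obtain ⟨xl, xh, c, gl, gh, d⟩ := h.dat (wd_lt s n) (hE.nf h n)
  have hl := d.hlip
  unfold lip at hl
  have hg : (0 : ℝ) < gl := by exact_mod_cast d.hg
  rcases hE.core hp h d with ⟨hc, rfl, h1, h2⟩ | ⟨hc, rfl, h1, h2⟩
  · rcases hF.core hp h d with ⟨_, _, h3, h4⟩ | ⟨_, hh, _⟩
    swap
    · exact absurd hh (by simp)
    unfold Tm
    rw [cond_f hc, cond_f hc, sgn_diff]
    rw [cond_f rfl] at hl
    unfold lipP at hl
    have hl' := Nat.le_of_ble_eq_true hl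
    have d1 := hd (n + 1)
    have d2 := hd (n - 1)
    rw [WT_succ] at d1
    rw [WT_pred] at d2
    exact lipP_real hg hC (Nat.cast_nonneg _) hp.blo hp.bhi h1 h3 d1 d2 (by exact_mod_cast hl')
  · rcases hF.core hp h d with ⟨_, hh, _⟩ | ⟨_, _, h3, h4⟩
    · exact absurd hh (by simp)
    unfold Tm
    rw [cond_t hc, cond_t hc, add_div, add_div, add_sub_add_left_eq_sub, sgn_diff]
    rw [cond_t rfl] at hl
    obtain ⟨nl, nh, e1, k1, k2⟩ := hE.nb2 n
    obtain ⟨pl, ph, e2, k3, k4⟩ := hE.pb2 n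
    obtain ⟨nl', nh', e1', k1', k2'⟩ := hF.nb2 n
    obtain ⟨pl', ph', e2', k3', k4'⟩ := hF.pb2 n
    rw [e1] at e1'
    rw [e2] at e2'
    simp only [Option.some.injEq, Prod.mk.injEq] at e1' e2'
    obtain ⟨rfl, rfl⟩ := e1'
    obtain ⟨rfl, rfl⟩ := e2'
    rw [e1, e2] at hl
    simp only [] at hl
    have d1 := hd (n + 2)
    rw [WT_succ2] at d1
    obtain ⟨x1, x2⟩ := (hE n).of_some d.hent
    obtain ⟨x3, x4⟩ := (hF n).of_some d.hent
    exact lipC_real hp x1 x2 x3 x4 k1 k2 k1' k2' k3 k4 k3' k4' (hE.bd h _) (hE.bd h _) (hF.bd h _)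
      (hF.bd h _) d.hg h1 h3 hl hC (WT_pred2 s n) (hd n) d1 (hd (n - 2))

/-- abstract fixed point existence -/
theorem fp_exists (D : Set (ℤ → ℝ)) (T : (ℤ → ℝ) → (ℤ → ℝ)) (W : ℤ → ℝ) (K : ℝ) (hK : 0 ≤ K)
    (hcl : ∀ f : ℕ → ℤ → ℝ, ∀ g : ℤ → ℝ, (∀ k, f k ∈ D) →
      (∀ n, Filter.Tendsto (fun k => f k n) Filter.atTop (nhds (g n))) → g ∈ D)
    (hT : ∀ u ∈ D, T u ∈ D)
    (hL : ∀ u ∈ D, ∀ v ∈ D, ∀ C : ℝ, 0 ≤ C → (∀ n, |u n - v n| ≤ C * W n) →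
      ∀ n, |T u n - T v n| ≤ 7 / 8 * (C * W n))
    (hB : ∀ u ∈ D, ∀ v ∈ D, ∀ n, |u n - v n| ≤ K * W n) (u0 : ℤ → ℝ) (hu0 : u0 ∈ D) :
    ∃ u ∈ D, T u = u := by
  have hD : ∀ k, T^[k] u0 ∈ D := by
    intro k
    induction k with
    | zero => exact hu0
    | succ k ih => rw [Function.iterate_succ_apply']; exact hT _ ih
  have hst : ∀ u ∈ D, ∀ v ∈ D, ∀ k n, |T^[k] u n - T^[k] v n| ≤ K * (7 / 8) ^ k * W n := by
    intro u hu v hv k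
    have hDu : ∀ w ∈ D, ∀ k, T^[k] w ∈ D := by
      intro w hw k
      induction k with
      | zero => exact hw
      | succ k ih => rw [Function.iterate_succ_apply']; exact hT _ ih
    induction k with
    | zero => intro n; simpa using hB u hu v hv n
    | succ k ih =>
      intro n
      rw [Function.iterate_succ_apply', Function.iterate_succ_apply']
      have := hL _ (hDu u hu k) _ (hDu v hv k) _ (by positivity) ih n
      refine this.trans (le_of_eq ?_)
      ring
  have hc : ∀ n, CauchySeq (fun k => T^[k] u0 n) := by
    intro n
    refine cauchySeq_of_le_geometric (7 / 8) (K * W n) (by norm_num) ?_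
    intro k
    rw [Real.dist_eq]
    have := hst u0 hu0 (T u0) (hT _ hu0) k n
    rw [← Function.iterate_succ_apply] at this
    refine this.trans (le_of_eq ?_)
    ring
  choose g hg using fun n => cauchySeq_tendsto_of_complete (hc n)
  have hgD : g ∈ D := hcl _ _ hD hg
  refine ⟨g, hgD, ?_⟩
  have hlim : ∀ k n, |T^[k] u0 n - g n| ≤ K * 8 * (7 / 8) ^ k * W n := by
    intro k n
    have := dist_le_of_le_geometric_of_tendsto (r := 7 / 8) (C := K * W n) (by norm_num)
      (f := fun k => T^[k] u0 n) (by
        intro k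
        rw [Real.dist_eq]
        have := hst u0 hu0 (T u0) (hT _ hu0) k n
        rw [← Function.iterate_succ_apply] at this
        refine this.trans (le_of_eq ?_)
        ring) (hg n) k
    rw [Real.dist_eq] at this
    refine this.trans (le_of_eq ?_)
    ring
  funext n
  have h1 : Filter.Tendsto (fun k => T^[k + 1] u0 n) Filter.atTop (nhds (g n)) :=
    (Filter.tendsto_add_atTop_iff_nat (f := fun k => T^[k] u0 n) 1).2 (hg n)
  have h2 : Filter.Tendsto (fun k => T^[k + 1] u0 n) Filter.atTop (nhds (T g n)) := by
    rw [tendsto_iff_dist_tendsto_zero]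
    refine squeeze_zero (fun _ => dist_nonneg) (g := fun k : ℕ => K * 8 * W n * (7 / 8 : ℝ) ^ k) ?_ ?_
    · intro k
      rw [Real.dist_eq, Function.iterate_succ_apply']
      have := hL _ (hD k) _ hgD _ (by positivity) (hlim k) n
      have hp := (abs_nonneg _).trans this
      linarith
    · have := (tendsto_pow_atTop_nhds_zero_of_lt_one (by norm_num : (0:ℝ) ≤ 7 / 8)
        (by norm_num)).const_mul (K * 8 * W n)
      simpa using this
  exact tendsto_nhds_unique h2 h1

theorem fp_unique (D : Set (ℤ → ℝ)) (T : (ℤ → ℝ) → (ℤ → ℝ)) (W : ℤ → ℝ) (K : ℝ) (hK : 0 ≤ K)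
    (hL : ∀ u ∈ D, ∀ v ∈ D, ∀ C : ℝ, 0 ≤ C → (∀ n, |u n - v n| ≤ C * W n) →
      ∀ n, |T u n - T v n| ≤ 7 / 8 * (C * W n))
    (hB : ∀ u ∈ D, ∀ v ∈ D, ∀ n, |u n - v n| ≤ K * W n) {u v : ℤ → ℝ} (hu : u ∈ D) (hv : v ∈ D)
    (eu : T u = u) (ev : T v = v) : u = v := by
  have h : ∀ k : ℕ, ∀ n, |u n - v n| ≤ K * (7 / 8) ^ k * W n := by
    intro k
    induction k with
    | zero => intro n; simpa using hB u hu v hv n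
    | succ k ih =>
      intro n
      have := hL u hu v hv _ (by positivity) ih n
      rw [eu, ev] at this
      refine this.trans (le_of_eq ?_)
      ring
  funext n
  have h2 : Filter.Tendsto (fun k : ℕ => K * W n * (7 / 8 : ℝ) ^ k) Filter.atTop (nhds 0) := by
    have := (tendsto_pow_atTop_nhds_zero_of_lt_one (by norm_num : (0:ℝ) ≤ 7 / 8)
        (by norm_num)).const_mul (K * W n)
    simpa using this
  have h3 : |u n - v n| ≤ 0 := ge_of_tendsto' h2 (fun k => (h k n).trans (le_of_eq (by ring)))
  exact sub_eq_zero.1 (abs_nonpos_iff.1 h3)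
theorem Encl.sgn {alo ahi t : ℕ} (h : Good alo ahi t) {s : ℤ → Fin 2} {u : ℤ → ℝ}
    (hE : Encl t s u) (n : ℤ) : (s n = 1 → 0 < u n) ∧ (s n = 0 → u n < 0) := by
  obtain ⟨xl, xh, c, gl, gh, d⟩ := h.dat (wd_lt s n) (hE.nf h n)
  obtain ⟨h1, h2⟩ := (hE n).of_some d.hent
  constructor
  · intro hs
    have : (65537 : ℝ) ≤ xl := by exact_mod_cast d.hsp ((tb5_t s n).2 hs)
    linarith
  · intro hs
    have : (xh : ℝ) ≤ 65535 := by exact_mod_cast d.hsn ((tb5_f s n).2 hs)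
    linarith

theorem orb_fixed {alo ahi t : ℕ} {a b : ℝ} (hp : Par alo ahi a b) (h : Good alo ahi t)
    {s : ℤ → Fin 2} {u : ℤ → ℝ} (ho : Orb a b s u) (hE : Encl t s u) : Tm a b s u = u := by
  funext n
  obtain ⟨xl, xh, c, gl, gh, d⟩ := h.dat (wd_lt s n) (hE.nf h n)
  unfold Tm
  rcases hE.core hp h d with ⟨hc, rfl, h1, h2⟩ | ⟨hc, rfl, h1, h2⟩
  · rw [cond_f hc, ← ho.sqrt_pz]; ring
  · rw [cond_t hc]
    have e := ho.cG n hc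
    have hs : √(cG a b (u n) (u (n + 2)) (u (n - 2))) = |2 * u n - 2560| := by
      rw [← e, Real.sqrt_sq_eq_abs]
    rcases hb : tb (wd s n) 5 with _ | _
    · have := ho.neg n ((tb5_f s n).1 hb)
      rw [cond_f rfl, hs, abs_of_neg (by linarith)]; ring
    · have h3 := ho.pos n ((tb5_t s n).1 hb)
      have h4 : (2561 : ℝ) ≤ gl := by exact_mod_cast d.hcg rfl hb
      rw [cond_t rfl, hs]
      rw [hs] at h1
      rcases le_total 0 (2 * u n - 2560) with h5 | h5
      · rw [abs_of_nonneg h5]; ring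
      · rw [abs_of_nonpos h5] at h1
        linarith

theorem fixed_orb {alo ahi t : ℕ} {a b : ℝ} (hp : Par alo ahi a b) (h : Good alo ahi t)
    {s : ℤ → Fin 2} {u : ℤ → ℝ} (hT : Tm a b s u = u) (hE : Encl t s u) : Orb a b s u := by
  have hpl : ∀ n, crit (wd s n) = false → (2 * u n) ^ 2 = pz a b (u (n + 1)) (u (n - 1)) ∧
      (s n = 1 → 2 * u n = √(pz a b (u (n + 1)) (u (n - 1)))) := by
    intro n hc
    obtain ⟨xl, xh, c, gl, gh, d⟩ := h.dat (wd_lt s n) (hE.nf h n)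
    have hg : (0 : ℝ) < gl := by exact_mod_cast d.hg
    rcases hE.core hp h d with ⟨_, rfl, h1, h2⟩ | ⟨hc', _⟩
    swap
    · rw [hc] at hc'; exact absurd hc' Bool.false_ne_true
    have hz := Real.sqrt_pos.1 (lt_of_lt_of_le hg h1)
    have e := congrFun hT n
    unfold Tm at e
    rw [cond_f hc] at e
    constructor
    · rw [← e]
      rcases hb : tb (wd s n) 5 with _ | _
      · rw [cond_f rfl]
        have := Real.sq_sqrt hz.le
        linarith
      · rw [cond_t rfl]
        have := Real.sq_sqrt hz.le
        linarith
    · intro hs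
      rw [cond_t ((tb5_t s n).2 hs)] at e
      linarith
  refine ⟨hE.bd h, ?_, fun n hs => ((hE.sgn h n).1 hs).le, fun n hs => ((hE.sgn h n).2 hs).le⟩
  intro n
  rcases hc : crit (wd s n) with _ | _
  · have := (hpl n hc).1
    unfold pz at this
    linarith
  · obtain ⟨c1, c2, c3⟩ := (crit_iff s n).1 hc
    have k1 : crit (wd s (n + 1)) = false := by
      rcases hb : crit (wd s (n + 1)) with _ | _
      · rfl
      · have := ((crit_iff s (n + 1)).1 hb).2.1
        rw [show n + 1 + 1 = n + 2 by ring, c3] at this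
        exact absurd this (by decide)
    have k2 : crit (wd s (n - 1)) = false := by
      rcases hb : crit (wd s (n - 1)) with _ | _
      · rfl
      · have := ((crit_iff s (n - 1)).1 hb).2.2
        rw [show n - 1 + 2 = n + 1 by ring, c2] at this
        exact absurd this (by decide)
    have e1 := (hpl _ k1).2 c2
    have e2 := (hpl _ k2).2 c1
    rw [show n + 1 + 1 = n + 2 by ring, show n + 1 - 1 = n by ring] at e1
    rw [show n - 1 + 1 = n by ring, show n - 1 - 1 = n - 2 by ring] at e2
    obtain ⟨xl, xh, c, gl, gh, d⟩ := h.dat (wd_lt s n) (hE.nf h n)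
    have hg : (0 : ℝ) < gl := by exact_mod_cast d.hg
    rcases hE.core hp h d with ⟨hc', _⟩ | ⟨_, rfl, h1, h2⟩
    · rw [hc] at hc'; exact absurd hc' (by simp)
    have hz := Real.sqrt_pos.1 (lt_of_lt_of_le hg h1)
    have e := congrFun hT n
    unfold Tm at e
    rw [cond_t hc] at e
    have e3 : (2 * u n - 2560) ^ 2 = cG a b (u n) (u (n + 2)) (u (n - 2)) := by
      have := Real.sq_sqrt hz.le
      rw [← this]
      generalize √(cG a b (u n) (u (n + 2)) (u (n - 2))) = g at *
      rw [← e]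
      rcases hb : tb (wd s n) 5 with _ | _
      · rw [cond_f rfl]; ring
      · rw [cond_t rfl]; ring
    unfold cG at e3
    rw [← e1, ← e2] at e3
    linarith

theorem diff_bd {alo ahi t : ℕ} (h : Good alo ahi t) {s : ℤ → Fin 2} {u v : ℤ → ℝ}
    (hE : Encl t s u) (hF : Encl t s v) (n : ℤ) : |u n - v n| ≤ 78642 * WT (wd s n) := by
  obtain ⟨xl, xh, c, gl, gh, d⟩ := h.dat (wd_lt s n) (hE.nf h n)
  have hW : (1 : ℝ) ≤ WT (wd s n) := by exact_mod_cast d.hW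
  have h1 := abs_le.1 (hE.bd h n)
  have h2 := abs_le.1 (hF.bd h n)
  have : |u n - v n| ≤ 78642 := by rw [abs_le]; constructor <;> linarith
  linarith

theorem orb_exists {alo ahi t : ℕ} {a b : ℝ} (hp : Par alo ahi a b) (h : Good alo ahi t)
    {s : ℤ → Fin 2} (hs : NF s) : ∃ u, Orb a b s u := by
  choose xl xh c gl gh d using fun n => h.dat (wd_lt s n) (hs n)
  obtain ⟨u, hu, hT⟩ := fp_exists {u | Encl t s u} (Tm a b s) (fun n => WT (wd s n)) 78642
    (by norm_num) (by
      intro f g hf hg n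
      refine ⟨xl n, xh n, (d n).hent, ?_, ?_⟩
      · exact ge_of_tendsto' ((hg n).add_const 65536) (fun k => ((hf k n).of_some (d n).hent).1)
      · exact le_of_tendsto' ((hg n).add_const 65536) (fun k => ((hf k n).of_some (d n).hent).2))
    (fun u hu => Tm_maps hp h hu) (fun u hu v hv C hC hd n => Tm_lip hp h hu hv hC hd n)
    (fun u hu v hv n => diff_bd h hu hv n) (fun n => (xl n : ℝ) - 65536) (by
      intro n
      refine ⟨xl n, xh n, (d n).hent, by simp, ?_⟩
      have : (xl n : ℝ) ≤ xh n := by exact_mod_cast (d n).hx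
      linarith)
  exact ⟨u, fixed_orb hp h hT hu⟩

theorem orb_unique {alo ahi t : ℕ} {a b : ℝ} (hp : Par alo ahi a b) (h : Good alo ahi t)
    {s : ℤ → Fin 2} {u v : ℤ → ℝ} (hu : Orb a b s u) (hv : Orb a b s v) (hE : Encl t s u)
    (hF : Encl t s v) : u = v :=
  fp_unique {u | Encl t s u} (Tm a b s) (fun n => WT (wd s n)) 78642 (by norm_num)
    (fun u hu v hv C hC hd n => Tm_lip hp h hu hv hC hd n)
    (fun u hu v hv n => diff_bd h hu hv n) hE hF (orb_fixed hp h hu hE) (orb_fixed hp h hv hF)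

/-- summary of the symbolic dynamics at a parameter -/
structure Summ (a b : ℝ) : Prop where
  nf : ∀ s u, Orb a b s u → NF s
  sp : ∀ s u, Orb a b s u → ∀ n, (s n = 1 → 0 < u n) ∧ (s n = 0 → u n < 0)
  ex : ∀ s, NF s → ∃ u, Orb a b s u
  un : ∀ s u v, Orb a b s u → Orb a b s v → u = v

theorem summ_of {alo ahi : ℕ} {a b : ℝ} (hp : Par alo ahi a b) (hc : check alo ahi = true) :
    Summ a b := by
  have h := good_of_check hc
  exact ⟨fun s u ho => (iter_sound hp ho 11).nf h, fun s u ho n => (iter_sound hp ho 11).sgn h n,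
    fun s hs => orb_exists hp h hs,
    fun s u v hu hv => orb_unique hp h hu hv (iter_sound hp hu 11) (iter_sound hp hv 11)⟩

theorem chk1 : check 36350 36537 = true := by decide +kernel
theorem chk2 : check 36535 36865 = true := by decide +kernel
theorem chk3 : check 36863 37250 = true := by decide +kernel
theorem chk4 : check 37248 37634 = true := by decide +kernel

theorem par_of {alo ahi : ℕ} {a b : ℝ} (h1 : (alo : ℝ) + 1 ≤ 16384 * a) (h2 : 16384 * a + 1 ≤ ahi)
    (h3 : |b - 1 / 4| ≤ 1 / 65536) (hh : ahi ≤ 37634) : Par alo ahi a b := by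
  have hb := abs_le.1 h3
  have key : ∀ t : ℝ, |t| ≤ 39321 → |(4 * b - 1) * t| ≤ 4 := by
    intro t ht
    rw [abs_mul, show 4 * b - 1 = 4 * (b - 1 / 4) by ring, abs_mul,
      abs_of_nonneg (by norm_num : (0:ℝ) ≤ 4)]
    have := mul_le_mul h3 ht (abs_nonneg _) (by norm_num)
    linarith
  refine ⟨?_, ?_, by linarith, by linarith, hh⟩
  · intro t ht
    have := abs_le.1 (key t ht)
    linarith
  · intro t ht
    have := abs_le.1 (key t ht)
    linarith

theorem summ {a b : ℝ} (ha : 36351 / 16384 < a) (ha' : a < 37633 / 16384)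
    (hb : 1 / 4 - 1 / 65536 < b) (hb' : b < 1 / 4 + 1 / 65536) : Summ a b := by
  have h3 : |b - 1 / 4| ≤ 1 / 65536 := by rw [abs_le]; constructor <;> linarith
  rcases le_total (16384 * a) 36536 with h | h
  · exact summ_of (par_of (by norm_num; linarith) (by norm_num; linarith) h3 (by norm_num)) chk1
  rcases le_total (16384 * a) 36864 with h | h
  · exact summ_of (par_of (by norm_num; linarith) (by norm_num; linarith) h3 (by norm_num)) chk2
  rcases le_total (16384 * a) 37249 with h | h
  · exact summ_of (par_of (by norm_num; linarith) (by norm_num; linarith) h3 (by norm_num)) chk3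
  · exact summ_of (par_of (by norm_num; linarith) (by norm_num; linarith) h3 (by norm_num)) chk4
theorem fix_iff (s : Sigma2) : s ∈ fixSet 0 2 ↔
    ∀ i, ¬ (s (i - 1) = 1 ∧ s (i + 1) = 1 ∧ s (i + 2) = 0 ∧ s (i + 3) = 0) := by
  have hp : ∀ i, pattern 0 2 s i ↔ (s (i - 1) = 1 ∧ s (i + 1) = 1 ∧ s (i + 2) = 0 ∧ s (i + 3) = 0) := by
    intro i
    unfold pattern
    constructor
    · rintro ⟨h1, h2, -, h4⟩
      have e1 := h4 1 (by omega) (by omega)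
      have e2 := h4 2 (by omega) (by omega)
      rw [show i + 1 + ((1 : ℕ) : ℤ) = i + 2 by push_cast; ring] at e1
      rw [show i + 1 + ((2 : ℕ) : ℤ) = i + 3 by push_cast; ring] at e2
      exact ⟨h1, h2, e1, e2⟩
    · rintro ⟨h1, h2, h3, h4⟩
      refine ⟨h1, h2, fun k hk hk' => by omega, fun k hk hk' => ?_⟩
      obtain rfl | rfl : k = 1 ∨ k = 2 := by omega
      · rw [show i + 1 + ((1 : ℕ) : ℤ) = i + 2 by push_cast; ring]; exact h3
      · rw [show i + 1 + ((2 : ℕ) : ℤ) = i + 3 by push_cast; ring]; exact h4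
  have hne : ∀ x : Fin 2, 1 - x ≠ x := by decide
  constructor
  · intro h i hi
    have h' : rho 0 2 s i = s i := congrFun h i
    unfold rho at h'
    rw [if_pos ((hp i).2 hi)] at h'
    exact hne _ h'
  · intro h
    change rho 0 2 s = s
    funext i
    unfold rho
    rw [if_neg (fun hh => h i ((hp i).1 hh))]

theorem v1 (x : Fin 2) : x = 1 ↔ x.val = 1 := by
  rw [Fin.ext_iff]; rfl
theorem v0 (x : Fin 2) : x = 0 ↔ x.val = 0 := by
  rw [Fin.ext_iff]; rfl

theorem forb1_iff (w i : ℕ) : forb1 w i = true ↔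
    (w / 2 ^ (i+4) % 2 = 1 ∧ w / 2 ^ (i+2) % 2 = 1 ∧ w / 2 ^ (i+1) % 2 = 0 ∧ w / 2 ^ i % 2 = 0) := by
  unfold forb1
  rw [Bool.and_eq_true, Bool.and_eq_true, Bool.and_eq_true, Bool.not_eq_true', Bool.not_eq_true',
    tb_iff, tb_iff, tb_false, tb_false]

theorem nf_iff (s : ℤ → Fin 2) : NF s ↔
    ∀ i, ¬ (s (i - 1) = 1 ∧ s (i + 1) = 1 ∧ s (i + 2) = 0 ∧ s (i + 3) = 0) := by
  have key : ∀ n, (forb1 (wd s n) 3 = true ↔ (s (n-2) = 1 ∧ s n = 1 ∧ s (n+1) = 0 ∧ s (n+2) = 0)) ∧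
      (forb1 (wd s n) 2 = true ↔ (s (n-1) = 1 ∧ s (n+1) = 1 ∧ s (n+2) = 0 ∧ s (n+3) = 0)) ∧
      (forb1 (wd s n) 1 = true ↔ (s n = 1 ∧ s (n+2) = 1 ∧ s (n+3) = 0 ∧ s (n+4) = 0)) ∧
      (forb1 (wd s n) 0 = true ↔ (s (n+1) = 1 ∧ s (n+3) = 1 ∧ s (n+4) = 0 ∧ s (n+5) = 0)) := by
    intro n
    simp only [forb1_iff, v0, v1, wd]
    have h1 := (s (n-2)).isLt
    have h2 := (s (n-1)).isLt
    have h3 := (s n).isLt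
    have h4 := (s (n+1)).isLt
    have h5 := (s (n+2)).isLt
    have h6 := (s (n+3)).isLt
    have h7 := (s (n+4)).isLt
    have h8 := (s (n+5)).isLt
    generalize (s (n-2)).val = x1 at *
    generalize (s (n-1)).val = x2 at *
    generalize (s n).val = x3 at *
    generalize (s (n+1)).val = x4 at *
    generalize (s (n+2)).val = x5 at *
    generalize (s (n+3)).val = x6 at *
    generalize (s (n+4)).val = x7 at *
    generalize (s (n+5)).val = x8 at *
    interval_cases x1 <;> interval_cases x2 <;> interval_cases x3 <;> interval_cases x4 <;>
    interval_cases x5 <;> interval_cases x6 <;> interval_cases x7 <;> interval_cases x8 <;> decide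
  constructor
  · intro h i hi
    have := h i
    unfold forb at this
    rw [((key i).2.1).2 hi] at this
    simp at this
  · intro h n
    obtain ⟨k3, k2, k1, k0⟩ := key n
    have e3 : forb1 (wd s n) 3 = false := by
      rw [← Bool.not_eq_true, k3]
      have := h (n - 1)
      rwa [show n - 1 - 1 = n - 2 by ring, show n - 1 + 1 = n by ring, show n - 1 + 2 = n + 1 by ring,
        show n - 1 + 3 = n + 2 by ring] at this
    have e2 : forb1 (wd s n) 2 = false := by
      rw [← Bool.not_eq_true, k2]; exact h n
    have e1 : forb1 (wd s n) 1 = false := by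
      rw [← Bool.not_eq_true, k1]
      have := h (n + 1)
      rwa [show n + 1 - 1 = n by ring, show n + 1 + 1 = n + 2 by ring, show n + 1 + 2 = n + 3 by ring,
        show n + 1 + 3 = n + 4 by ring] at this
    have e0 : forb1 (wd s n) 0 = false := by
      rw [← Bool.not_eq_true, k0]
      have := h (n + 2)
      rwa [show n + 2 - 1 = n + 1 by ring, show n + 2 + 1 = n + 3 by ring, show n + 2 + 2 = n + 4 by ring,
        show n + 2 + 3 = n + 5 by ring] at this
    unfold forb
    rw [e3, e2, e1, e0]; rfl

/-- Henon as a homeomorphism -/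
noncomputable def he (a b : ℝ) (hb : b ≠ 0) : (ℝ × ℝ) ≃ₜ (ℝ × ℝ) where
  toFun := henon a b
  invFun q := (q.2, (a - q.2 ^ 2 - q.1) / b)
  left_inv p := by
    unfold henon
    ext
    · rfl
    · field_simp; ring
  right_inv p := by
    unfold henon
    ext
    · field_simp; ring
    · rfl
  continuous_toFun := by unfold henon; fun_prop
  continuous_invFun := by fun_prop

theorem orb_eq {a b : ℝ} (hb : b ≠ 0) {o : ℤ → ℝ × ℝ} (ho : ∀ n : ℤ, o (n + 1) = henon a b (o n))
    (n : ℤ) : o n = ((he a b hb) ^ n) (o 0) := by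
  induction n using Int.induction_on with
  | zero => simp
  | succ i ih =>
    rw [ho, ih, add_comm, zpow_add, zpow_one]; rfl
  | pred i ih =>
    have h1 := ho (-(i : ℤ) - 1)
    rw [sub_add_cancel, ih] at h1
    apply (he a b hb).injective
    have h2 : (he a b hb) (((he a b hb) ^ (-(i : ℤ) - 1)) (o 0)) = ((he a b hb) ^ (-(i : ℤ))) (o 0) := by
      conv_rhs => rw [show -(i : ℤ) = 1 + (-(i : ℤ) - 1) by ring, zpow_add, zpow_one]
      rfl
    rw [h2, h1]; rfl

theorem pw_succ (a b : ℝ) (hb : b ≠ 0) (p : ℝ × ℝ) (n : ℤ) :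
    ((he a b hb) ^ (n + 1)) p = henon a b (((he a b hb) ^ n) p) := by
  rw [add_comm, zpow_add, zpow_one]; rfl

theorem pw_comm (a b : ℝ) (hb : b ≠ 0) (p : ℝ × ℝ) (n : ℤ) :
    ((he a b hb) ^ n) (henon a b p) = ((he a b hb) ^ (n + 1)) p := by
  rw [zpow_add, zpow_one]; rfl

/-- coordinate along orbit -/
noncomputable def xc (a b : ℝ) (hb : b ≠ 0) (n : ℤ) (p : ℝ × ℝ) : ℝ := (((he a b hb) ^ n) p).1

theorem xc_cont (a b : ℝ) (hb : b ≠ 0) (n : ℤ) : Continuous (xc a b hb n) :=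
  continuous_fst.comp ((he a b hb) ^ n).continuous

theorem snd_eq (a b : ℝ) (hb : b ≠ 0) (n : ℤ) (p : ℝ × ℝ) :
    (((he a b hb) ^ n) p).2 = xc a b hb (n - 1) p := by
  have := pw_succ a b hb p (n - 1)
  rw [sub_add_cancel] at this
  rw [this]; rfl

theorem xc_rec (a b : ℝ) (hb : b ≠ 0) (n : ℤ) (p : ℝ × ℝ) :
    xc a b hb (n + 1) p = a - xc a b hb n p ^ 2 - b * xc a b hb (n - 1) p := by
  have := congrArg Prod.fst (pw_succ a b hb p n)
  unfold henon at this
  simp only [snd_eq] at this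
  exact this

theorem xc_zero (a b : ℝ) (hb : b ≠ 0) (p : ℝ × ℝ) : xc a b hb 0 p = p.1 := by
  simp [xc]

theorem xc_neg (a b : ℝ) (hb : b ≠ 0) (p : ℝ × ℝ) : xc a b hb (-1) p = p.2 := by
  have := snd_eq a b hb 0 p
  simp at this
  exact this.symm

theorem xc_henon (a b : ℝ) (hb : b ≠ 0) (p : ℝ × ℝ) (n : ℤ) :
    xc a b hb n (henon a b p) = xc a b hb (n + 1) p := by
  unfold xc; rw [pw_comm]

theorem mem_iff {a b : ℝ} (hb0 : b ≠ 0) (ha : 0 < a) (ha' : a < 37633/16384)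
    (hb : 0 < b) (hb' : b < 1/4 + 1/65536) (p : ℝ × ℝ) :
    p ∈ henonK a b ↔ ∀ n, |xc a b hb0 n p| ≤ 39321/16384 := by
  constructor
  · rintro ⟨o, h0, ho, hbd⟩
    have hoe : ∀ n, o n = ((he a b hb0) ^ n) p := fun n => by rw [orb_eq hb0 ho n, h0]
    obtain ⟨C, hC⟩ := hbd.exists_norm_le
    have hC' : ∀ n, |xc a b hb0 n p| ≤ C := by
      intro n
      have h1 := hC (o n) ⟨n, rfl⟩
      rw [hoe] at h1
      exact le_trans (norm_fst_le (((he a b hb0) ^ n) p)) h1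
    have hB : BddAbove (Set.range fun n => |xc a b hb0 n p|) := ⟨C, by rintro _ ⟨n, rfl⟩; exact hC' n⟩
    set M := ⨆ n, |xc a b hb0 n p| with hM
    have hle : ∀ n, |xc a b hb0 n p| ≤ M := fun n => le_ciSup hB n
    have hM0 : 0 ≤ M := le_trans (abs_nonneg _) (hle 0)
    have hsq : M ≤ Real.sqrt (a + M + b * M) := by
      apply ciSup_le
      intro n
      apply Real.abs_le_sqrt
      have := xc_rec a b hb0 n p
      have h1 := abs_le.1 (hle (n+1))
      have h2 := abs_le.1 (hle (n-1))
      nlinarith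
    have hq : M ^ 2 ≤ a + M + b * M := by
      have := Real.sq_sqrt (show 0 ≤ a + M + b * M by positivity)
      nlinarith
    have : M ≤ 39321/16384 := by
      by_contra hc
      push Not at hc
      nlinarith
    exact fun n => (hle n).trans this
  · intro h
    refine ⟨fun n => ((he a b hb0) ^ n) p, by simp, fun n => pw_succ a b hb0 p n, ?_⟩
    refine isBounded_iff_forall_norm_le.2 ⟨39321/16384, ?_⟩
    rintro _ ⟨n, rfl⟩
    refine norm_prod_le_iff.2 ⟨h n, ?_⟩
    rw [snd_eq]; exact h (n - 1)

open Classical in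
/-- itinerary -/
noncomputable def cd (a b : ℝ) (hb : b ≠ 0) (p : ℝ × ℝ) : ℤ → Fin 2 :=
  fun n => if 0 < xc a b hb n p then 1 else 0

theorem cd_orb {a b : ℝ} (hb0 : b ≠ 0) {p : ℝ × ℝ} (h : ∀ n, |xc a b hb0 n p| ≤ 39321/16384) :
    Orb a b (cd a b hb0 p) (fun n => 16384 * xc a b hb0 n p) where
  bd n := by
    rw [abs_mul, abs_of_pos (by norm_num : (0:ℝ) < 16384)]
    have := h n
    linarith
  eq n := by
    have := xc_rec a b hb0 n p
    simp only [this]; ring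
  pos n hn := by
    unfold cd at hn
    split_ifs at hn with hh
    · positivity
    · exact absurd hn (by decide)
  neg n hn := by
    unfold cd at hn
    split_ifs at hn with hh
    · exact absurd hn (by decide)
    · push Not at hh
      linarith

theorem xc_ne {a b : ℝ} (S : Summ a b) (hb0 : b ≠ 0) {p : ℝ × ℝ}
    (h : ∀ n, |xc a b hb0 n p| ≤ 39321/16384) (n : ℤ) : xc a b hb0 n p ≠ 0 := by
  intro h0
  obtain ⟨h1, h2⟩ := S.sp _ _ (cd_orb hb0 h) n
  have : cd a b hb0 p n = 0 := by unfold cd; rw [if_neg]; rw [h0]; exact lt_irrefl _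
  have := h2 this
  simp only [h0] at this
  norm_num at this

theorem compactK {a b : ℝ} (hb0 : b ≠ 0) (ha : 0 < a) (ha' : a < 37633/16384)
    (hb : 0 < b) (hb' : b < 1/4 + 1/65536) : IsCompact (henonK a b) := by
  have he : henonK a b = ⋂ n, {p | |xc a b hb0 n p| ≤ 39321/16384} := by
    ext p; rw [mem_iff hb0 ha ha' hb hb', Set.mem_iInter]; rfl
  apply Metric.isCompact_of_isClosed_isBounded
  · rw [he]
    exact isClosed_iInter fun n => isClosed_le (xc_cont a b hb0 n).abs continuous_const
  · refine isBounded_iff_forall_norm_le.2 ⟨39321/16384, ?_⟩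
    intro p hp
    rw [mem_iff hb0 ha ha' hb hb'] at hp
    have h0 := hp 0
    have h1 := hp (-1)
    rw [xc_zero] at h0
    rw [xc_neg] at h1
    exact norm_prod_le_iff.2 ⟨h0, h1⟩

theorem conj {a b : ℝ} (ha : 36351/16384 < a) (ha' : a < 37633/16384)
    (hb : 1/4 - 1/65536 < b) (hb' : b < 1/4 + 1/65536) :
    Set.MapsTo (henon a b) (henonK a b) (henonK a b) ∧
        ∃ h : (henonK a b) ≃ₜ (fixSet 0 2),
          ∀ (p : henonK a b) (hq : henon a b (p : ℝ × ℝ) ∈ henonK a b),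
            (h ⟨henon a b (p : ℝ × ℝ), hq⟩ : Sigma2) = shift (h p) := by
  have S := summ ha ha' hb hb'
  have ha0 : 0 < a := by linarith
  have hbp : 0 < b := by linarith
  have hb0 : b ≠ 0 := hbp.ne'
  have hm := mem_iff hb0 ha0 ha' hbp hb'
  constructor
  · intro p hp
    rw [hm] at hp ⊢
    intro n
    rw [xc_henon]; exact hp _
  have hfix : ∀ s : Sigma2, s ∈ fixSet 0 2 ↔ NF s := fun s => (fix_iff s).trans (nf_iff s).symm
  have hK : ∀ p : henonK a b, ∀ n, |xc a b hb0 n p| ≤ 39321/16384 := fun p => (hm p).1 p.2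
  let f : henonK a b → fixSet 0 2 := fun p =>
    ⟨cd a b hb0 p, (hfix _).2 (S.nf _ _ (cd_orb hb0 (hK p)))⟩
  have fc : Continuous f := by
    refine Continuous.subtype_mk (continuous_pi fun n => ?_) _
    have hx : Continuous fun p : henonK a b => xc a b hb0 n p :=
      (xc_cont a b hb0 n).comp continuous_subtype_val
    unfold cd
    refine Continuous.if ?_ continuous_const continuous_const
    intro p hp
    have := frontier_lt_subset_eq continuous_const hx hp
    exact absurd this.symm (xc_ne S hb0 (hK p) n)
  have finj : Function.Injective f := by
    intro p q hpq
    have hc : cd a b hb0 p = cd a b hb0 q := congrArg Subtype.val hpq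
    have h1 := cd_orb hb0 (hK p)
    rw [hc] at h1
    have h2 := S.un _ _ _ h1 (cd_orb hb0 (hK q))
    have e0 := congrFun h2 0
    have e1 := congrFun h2 (-1)
    simp only [xc_zero] at e0
    simp only [xc_neg] at e1
    apply Subtype.ext
    apply Prod.ext <;> linarith
  have fsurj : Function.Surjective f := by
    rintro ⟨s, hs⟩
    obtain ⟨u, hu⟩ := S.ex s ((hfix s).1 hs)
    let o : ℤ → ℝ × ℝ := fun n => (u n / 16384, u (n - 1) / 16384)
    have ho : ∀ n : ℤ, o (n + 1) = henon a b (o n) := by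
      intro n
      have := hu.eq n
      simp only [o, henon, add_sub_cancel_right]
      ext
      · simp only []; linarith
      · rfl
    have hx : ∀ n, xc a b hb0 n (o 0) = u n / 16384 := by
      intro n
      unfold xc
      rw [← orb_eq hb0 ho n]
    have hmem : o 0 ∈ henonK a b := by
      rw [hm]
      intro n
      rw [hx, abs_div, abs_of_pos (by norm_num : (0:ℝ) < 16384)]
      have := hu.bd n
      linarith
    refine ⟨⟨o 0, hmem⟩, Subtype.ext ?_⟩
    change cd a b hb0 (o 0) = s
    funext n
    unfold cd
    rw [hx]
    obtain ⟨h1, h2⟩ := S.sp s u hu n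
    rcases fin2_cases (s n) with h | h
    · rw [← v0] at h
      have := h2 h
      rw [if_neg (by linarith), h]
    · rw [← v1] at h
      have := h1 h
      rw [if_pos (by linarith), h]
  haveI : CompactSpace (henonK a b) :=
    isCompact_iff_compactSpace.1 (compactK hb0 ha0 ha' hbp hb')
  refine ⟨Continuous.homeoOfEquivCompactToT2 (f := Equiv.ofBijective f ⟨finj, fsurj⟩) fc, ?_⟩
  intro p hq
  change cd a b hb0 (henon a b p) = shift (cd a b hb0 p)
  funext n
  unfold cd shift
  rw [xc_henon]
end HP

/-- (Main theorem, second component) There is an open connected set `A₂ ⊆ ℝ²`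
containing the segment `[2.21875, 2.296875] × {0.25}` such that for all
`(a,b) ∈ A₂`, the Hénon map `H_{a,b}` restricted to `K^ℝ_{a,b}` is topologically
conjugate to the shift restricted to `Fix(ρ_{0,2})`. -/
theorem henon_pruning_component_two :
    ∃ A₂ : Set (ℝ × ℝ), IsOpen A₂ ∧ IsConnected A₂ ∧
      (Set.Icc (2.21875 : ℝ) 2.296875) ×ˢ ({0.25} : Set ℝ) ⊆ A₂ ∧
      ∀ a b : ℝ, (a, b) ∈ A₂ →
        Set.MapsTo (henon a b) (henonK a b) (henonK a b) ∧
        ∃ h : (henonK a b) ≃ₜ (fixSet 0 2),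
          ∀ (p : henonK a b) (hq : henon a b (p : ℝ × ℝ) ∈ henonK a b),
            (h ⟨henon a b (p : ℝ × ℝ), hq⟩ : Sigma2) = shift (h p) := by
  refine ⟨Set.Ioo (36351/16384) (37633/16384) ×ˢ Set.Ioo (1/4 - 1/65536) (1/4 + 1/65536),
    isOpen_Ioo.prod isOpen_Ioo, ⟨⟨(9/4, 1/4), ?_⟩, isPreconnected_Ioo.prod isPreconnected_Ioo⟩, ?_, ?_⟩
  · constructor <;> constructor <;> norm_num
  · rintro ⟨x, y⟩ ⟨⟨h1, h2⟩, h3⟩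
    have h3' : y = 0.25 := h3
    subst h3'
    simp only at h1 h2
    norm_num at h1 h2
    constructor <;> constructor <;> simp only <;> first | linarith | norm_num
  · rintro a b ⟨⟨h1, h2⟩, h3, h4⟩
    exact HP.conj h1 h2 h3 h4
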